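/- Let B ⊆ ℂ^d be an open ball centered at the origin, let F, G : B → ℂ^g be holomorphic with F(0) = 0 and G(0) = 0, and let τ : B → M_g(ℂ) be holomorphic with det(Im τ(0)) ≠ 0, satisfying dG = τ·dF, i.e., ∂G/∂z_m(z) = τ(z)·∂F/∂z_m(z) for every m = 1, …, d and every z ∈ B. If there is a sequence of points x_i ∈ B ∖ {0} converging to the origin with Im F(x_i) = 0 and Im G(x_i) = 0 for all i, then there is a subsequence x_{i_k} along which F(x_{i_k}) = 0 and G(x_{i_k}) = 0 for all k; in particular the common zero locus V(F, G) contains a sequence of nonzero points converging to the origin. -/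

import Mathlib

open Metric Filter Matrix

theorem fs_field (K L : Type) [Field K] [Field L] [CharZero K] [Algebra K L] :
    Algebra.FormallySmooth K L := by
  obtain ⟨s, hs⟩ := exists_isTranscendenceBasis K L
  have := hs.isAlgebraic_field
  have : Algebra.IsSeparable (IntermediateField.adjoin K (Set.range ((↑) : s → L))) L := 
    inferInstance
  exact .of_algebraicIndependent_of_isSeparable hs.1

theorem fs_dom (A L : Type) [CommRing A] [IsDomain A] [Field L] [CharZero L] [Algebra A L]
    [FaithfulSMul A L] :
    Algebra.FormallySmooth A L := by
  let := FractionRing.liftAlgebra A L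
  have : IsScalarTower A (FractionRing A) L := FractionRing.isScalarTower_liftAlgebra A L
  have : CharZero (FractionRing A) := 
    ⟨fun m n h => by
      have := congrArg (algebraMap (FractionRing A) L) h
      simpa using this⟩
  have := fs_field (FractionRing A) L
  have : Algebra.FormallySmooth A (FractionRing A) := .of_isLocalization (nonZeroDivisors A)
  exact .comp A (FractionRing A) L

/-- Extension of derivations in characteristic zero. -/
theorem ext_deriv (A L : Type) [CommRing A] [IsDomain A] [Field L] [CharZero L] [Algebra A L]
    [Algebra ℂ A] [Algebra ℂ L] [IsScalarTower ℂ A L]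
    [FaithfulSMul A L] (D : Derivation ℂ A L) :
    ∃ D' : Derivation ℂ L L, ∀ a, D' (algebraMap A L a) = D a := by
  let φ : A →+* DualNumber L :=
    { toFun := fun a => TrivSqZeroExt.inl (algebraMap A L a) + TrivSqZeroExt.inr (D a)
      map_one' := by ext <;> simp
      map_zero' := by ext <;> simp
      map_add' := fun a b => by ext <;> simp
      map_mul' := fun a b => by 
        ext 
        · simp
        · simp only [Derivation.leibniz, Algebra.smul_def, TrivSqZeroExt.snd_add,
            TrivSqZeroExt.snd_inl, TrivSqZeroExt.snd_inr, TrivSqZeroExt.snd_mul,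
            TrivSqZeroExt.fst_add, TrivSqZeroExt.fst_inl, TrivSqZeroExt.fst_inr]
          simp only [zero_add, add_zero, Algebra.algebraMap_self_apply, MulOpposite.smul_eq_mul_unop, MulOpposite.unop_op]
          ring }
  let : Algebra A (DualNumber L) := φ.toAlgebra
  have hφ : ∀ a, algebraMap A (DualNumber L) a = φ a := fun _ => rfl
  have := fs_dom A L
  let g : DualNumber L →ₐ[A] L := 
    { (TrivSqZeroExt.fstHom L L L).toRingHom with
      commutes' := fun a => by simp [hφ, φ] }
  have hg : ∀ x, g x = x.fst := fun _ => rfl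
  have hsurj : Function.Surjective g := fun x => ⟨TrivSqZeroExt.inl x, by simp [hg]⟩
  have hnil : IsNilpotent (RingHom.ker (g : DualNumber L →+* L)) := by
    refine ⟨2, ?_⟩
    refine (pow_two (RingHom.ker (g : DualNumber L →+* L))).trans ?_
    rw [Ideal.zero_eq_bot, eq_bot_iff, Ideal.mul_le]
    intro r hr s hs
    have hr' : r.fst = 0 := hr
    have hs' : s.fst = 0 := hs
    rw [Ideal.mem_bot]
    ext <;> simp [hr', hs']
  let ψ := Algebra.FormallySmooth.liftOfSurjective (AlgHom.id A L) g hsurj hnil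
  have hψ : ∀ x, (ψ x).fst = x := fun x => by
    have := Algebra.FormallySmooth.liftOfSurjective_apply (AlgHom.id A L) g hsurj hnil x
    simpa [hg] using this
  have hψA : ∀ a, (ψ (algebraMap A L a)).snd = D a := fun a => by
    rw [ψ.commutes, hφ]; simp [φ]
  have hψC : ∀ c : ℂ, (ψ (algebraMap ℂ L c)).snd = 0 := fun c => by
    rw [IsScalarTower.algebraMap_apply ℂ A L, hψA]; simp
  refine ⟨Derivation.mk' 
    { toFun := fun x => (ψ x).snd
      map_add' := fun x y => by simp
      map_smul' := fun c x => by 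
        rw [Algebra.smul_def, map_mul, TrivSqZeroExt.snd_mul, hψ, hψ, hψC]
        simp [Algebra.smul_def] } ?_, hψA⟩
  intro a b
  simp [hψ, mul_comm]


/-- The closed unit disc. -/
abbrev Dk : Type := closedBall (0 : ℂ) 1

/-- The disc algebra. -/
def DA : Subalgebra ℂ C(Dk, ℂ) where
  carrier := {f | ∃ F : ℂ → ℂ, DifferentiableOn ℂ F (ball 0 1) ∧ ∀ z : Dk, F z = f z}
  mul_mem' := by
    rintro f g ⟨F, hF, hF'⟩ ⟨G, hG, hG'⟩
    exact ⟨fun z => F z * G z, hF.mul hG, fun z => by simp [hF', hG']⟩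
  add_mem' := by
    rintro f g ⟨F, hF, hF'⟩ ⟨G, hG, hG'⟩
    exact ⟨fun z => F z + G z, hF.add hG, fun z => by simp [hF', hG']⟩
  algebraMap_mem' := fun c => ⟨fun _ => c, differentiableOn_const _, fun z => rfl⟩

theorem DA_closed : IsClosed (DA : Set C(Dk, ℂ)) := by
  rw [← isSeqClosed_iff_isClosed]
  intro u f hu hf
  choose F hF hF' using hu
  classical
  let G : ℂ → ℂ := fun z => if h : z ∈ closedBall (0 : ℂ) 1 then f ⟨z, h⟩ else 0
  refine ⟨G, ?_, fun z => by simp only [G, dif_pos z.2]⟩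
  have : TendstoUniformlyOn F G atTop (ball 0 1) := by
    have h1 := (ContinuousMap.tendsto_iff_tendstoUniformly).1 hf
    rw [Metric.tendstoUniformly_iff] at h1
    rw [Metric.tendstoUniformlyOn_iff]
    intro ε hε
    filter_upwards [h1 ε hε] with n hn z hz
    have hz' := ball_subset_closedBall hz
    have := hn ⟨z, hz'⟩
    rw [← hF'] at this
    simpa only [G, dif_pos hz'] using this
  exact this.tendstoLocallyUniformlyOn.differentiableOn (Eventually.of_forall hF) isOpen_ball

instance : CompleteSpace DA := DA_closed.completeSpace_coe

/-- Constructor for the disc algebra. -/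
noncomputable def DA.mk' (F : ℂ → ℂ) (hc : ContinuousOn F (closedBall 0 1))
    (hd : DifferentiableOn ℂ F (ball 0 1)) : DA :=
  ⟨⟨fun z => F z, hc.comp_continuous continuous_subtype_val (fun z => z.2)⟩, F, hd, fun _ => rfl⟩

@[simp] theorem DA.mk'_apply (F : ℂ → ℂ) (hc hd) (z : Dk) : (DA.mk' F hc hd).1 z = F z := rfl

theorem DA.ext' {f g : DA} (h : ∀ z : Dk, f.1 z = g.1 z) : f = g :=
  Subtype.ext (ContinuousMap.ext h)

/-- Zero in the disc. -/
def Dk0 : Dk := ⟨0, by simp⟩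

theorem DA.div1 (f : DA) : ∃ g : DA, ∀ z : Dk, f.1 z = f.1 Dk0 + z * g.1 z := by
  obtain ⟨⟨f, hfc⟩, F, hF, hF'⟩ := f
  have hc : ContinuousOn F (closedBall 0 1) := by
    rw [continuousOn_iff_continuous_domRestrict]
    convert hfc using 1
    ext z; exact hF' z
  have h0 : ball (0 : ℂ) 1 ∈ nhds (0 : ℂ) := ball_mem_nhds _ one_pos
  have hd0 : DifferentiableAt ℂ F 0 := hF.differentiableAt h0
  refine ⟨DA.mk' (dslope F 0) ?_ ?_, fun z => ?_⟩
  · exact (continuousOn_dslope (mem_of_superset h0 ball_subset_closedBall)).2 ⟨hc, hd0⟩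
  · exact (Complex.differentiableOn_dslope h0).2 hF
  · have := sub_smul_dslope F 0 (z : ℂ)
    simp only [sub_zero, smul_eq_mul] at this
    rw [DA.mk'_apply, this, ← hF' z, ← hF' Dk0]
    simp [Dk0]

theorem DA.divb (b : ℕ) (f : DA) : ∃ (g : DA) (r : Fin b → ℂ),
    ∀ z : Dk, f.1 z = z ^ b * g.1 z + ∑ j, r j * (z : ℂ) ^ (j : ℕ) := by
  induction b with
  | zero => exact ⟨f, fun _ => 0, fun z => by simp⟩
  | succ b ih =>
    obtain ⟨g, r, h⟩ := ih
    obtain ⟨g', h'⟩ := DA.div1 g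
    refine ⟨g', Fin.snoc r (g.1 Dk0), fun z => ?_⟩
    rw [h z, h' z, Fin.sum_univ_castSucc]
    simp
    ring

/-- The coordinate in the disc algebra. -/
noncomputable def DA.Z : DA := DA.mk' (fun z => z) continuousOn_id differentiableOn_id

theorem DA.divb_unique (b : ℕ) (g : DA) (r : Fin b → ℂ)
    (h : ∀ z : Dk, (z : ℂ) ^ b * g.1 z + ∑ j, r j * (z : ℂ) ^ (j : ℕ) = 0) : g = 0 ∧ r = 0 := by
  induction b generalizing g with
  | zero => exact ⟨DA.ext' fun z => by simpa using h z, Subsingleton.elim _ _⟩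
  | succ b ih =>
    have := ih (DA.Z * g + algebraMap ℂ DA (r (Fin.last b))) (fun j => r j.castSucc) (fun z => by
      have hz := h z
      rw [Fin.sum_univ_castSucc] at hz
      have : (DA.Z * g + algebraMap ℂ DA (r (Fin.last b))).1 z
        = z * g.1 z + r (Fin.last b) := rfl
      rw [this]
      simp only [Fin.val_castSucc, Fin.val_last] at hz
      linear_combination hz)
    obtain ⟨h1, h2⟩ := this
    have h3 : ∀ z : Dk, (z : ℂ) * g.1 z + r (Fin.last b) = 0 := fun z =>
      congrArg (fun f : DA => f.1 z) h1
    have h4 : r (Fin.last b) = 0 := by simpa [Dk0] using h3 Dk0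
    have h5 : ∀ z : Dk, z ≠ Dk0 → g.1 z = 0 := fun z hz => by
      have := h3 z
      rw [h4, add_zero, mul_eq_zero] at this
      rcases this with h | h
      · exact absurd (Subtype.ext h) hz
      · exact h
    have h6 : g.1 Dk0 = 0 := by
      have hs : Tendsto (fun n : ℕ => ((1 : ℂ) / ((n : ℂ) + 1))) atTop (nhds 0) :=
        tendsto_one_div_add_atTop_nhds_zero_nat
      have hm : ∀ n : ℕ, ((1 : ℂ) / ((n : ℂ) + 1)) ∈ closedBall (0 : ℂ) 1 := fun n => by
        rw [mem_closedBall_zero_iff, norm_div, norm_one]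
        have : ‖(n : ℂ) + 1‖ = n + 1 := by
          have : (n : ℂ) + 1 = ((n + 1 : ℕ) : ℂ) := by push_cast; rfl
          rw [this, Complex.norm_natCast]; push_cast; rfl
        rw [this, div_le_one (by positivity)]
        linarith [Nat.cast_nonneg (α := ℝ) n]
      have hs' : Tendsto (fun n : ℕ => (⟨_, hm n⟩ : Dk)) atTop (nhds Dk0) :=
        tendsto_subtype_rng.2 hs
      have := (g.1.continuous.tendsto Dk0).comp hs'
      refine tendsto_nhds_unique this ?_
      refine tendsto_const_nhds.congr fun n => ?_
      refine (h5 _ fun h => ?_).symm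
      have := congrArg Subtype.val h
      simp only [Dk0, one_div, inv_eq_zero] at this
      exact Nat.cast_add_one_ne_zero n this
    refine ⟨DA.ext' fun z => ?_, ?_⟩
    · by_cases hz : z = Dk0
      · rw [hz, h6]; rfl
      · rw [h5 z hz]; rfl
    · ext j
      refine Fin.lastCases ?_ (fun j => ?_) j
      · exact h4
      · exact congrFun h2 j

/-- Polynomials in the disc algebra. -/
noncomputable def DA.P (b : ℕ) : (Fin b → ℂ) →L[ℂ] DA :=
  ∑ j : Fin b, (ContinuousLinearMap.proj (R := ℂ) (φ := fun _ : Fin b => ℂ) j).smulRight (DA.Z ^ (j : ℕ))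

theorem DA.eval_sum {ι : Type*} (s : Finset ι) (f : ι → DA) (z : Dk) :
    (∑ j ∈ s, f j).1 z = ∑ j ∈ s, (f j).1 z := by
  classical
  induction s using Finset.induction_on with
  | empty => simp
  | insert a s ha ih => 
    rw [Finset.sum_insert ha, Finset.sum_insert ha, ← ih]; rfl

theorem DA.P_apply (b : ℕ) (r : Fin b → ℂ) (z : Dk) :
    (DA.P b r).1 z = ∑ j, r j * (z : ℂ) ^ (j : ℕ) := by
  simp only [DA.P, _root_.sum_apply, ContinuousLinearMap.smulRight_apply,
    ContinuousLinearMap.proj_apply]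
  rw [DA.eval_sum]
  rfl

/-- Weierstrass operator. -/
noncomputable def DA.T (b : ℕ) (h : DA) : (DA × (Fin b → ℂ)) →L[ℂ] DA :=
  (ContinuousLinearMap.mul ℂ DA h).comp (ContinuousLinearMap.fst ℂ DA (Fin b → ℂ)) +
    (DA.P b).comp (ContinuousLinearMap.snd ℂ DA (Fin b → ℂ))

theorem DA.T_apply (b : ℕ) (h : DA) (q : DA) (r : Fin b → ℂ) (z : Dk) :
    (DA.T b h (q, r)).1 z = h.1 z * q.1 z + ∑ j, r j * (z : ℂ) ^ (j : ℕ) := by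
  rw [← DA.P_apply]; rfl

theorem DA.T_analytic (b : ℕ) (h : DA) : AnalyticAt ℂ (DA.T b) h := by
  unfold DA.T
  have h1 : AnalyticAt ℂ (fun h : DA => (ContinuousLinearMap.mul ℂ DA h).comp
      (ContinuousLinearMap.fst ℂ DA (Fin b → ℂ))) h := by
    let L1 : DA →L[ℂ] (DA →L[ℂ] DA) := ContinuousLinearMap.mul ℂ DA
    let L2 : (DA →L[ℂ] DA) →L[ℂ] ((DA × (Fin b → ℂ)) →L[ℂ] DA) :=
      (ContinuousLinearMap.compL ℂ (DA × (Fin b → ℂ)) DA DA).flip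
      (ContinuousLinearMap.fst ℂ DA (Fin b → ℂ))
    have h2 : AnalyticAt ℂ (fun h => (L2.comp L1) h) h :=
      ContinuousLinearMap.analyticAt (𝕜 := ℂ) (E := DA) (F := (DA × (Fin b → ℂ)) →L[ℂ] DA)
        (L2.comp L1) h
    exact h2
  exact h1.add analyticAt_const

theorem DA.T_bij (b : ℕ) (h u v : DA) (huv : u * v = 1)
    (hu : ∀ z : Dk, h.1 z = (z : ℂ) ^ b * u.1 z) :
    Function.Bijective (DA.T b h) := by
  have huv' : ∀ z : Dk, u.1 z * v.1 z = 1 := fun z => congrArg (fun f : DA => f.1 z) huv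
  constructor
  · rw [injective_iff_map_eq_zero]
    rintro ⟨q, r⟩ h0
    have := DA.divb_unique b (u * q) r (fun z => by
      have := congrArg (fun f : DA => f.1 z) h0
      simp only [DA.T_apply, hu] at this
      have e : (u * q).1 z = u.1 z * q.1 z := rfl
      rw [e, ← mul_assoc]
      exact this)
    obtain ⟨h1, h2⟩ := this
    have : q = 0 := by
      calc q = (u * v) * q := by rw [huv, one_mul]
        _ = v * (u * q) := by ring
        _ = 0 := by rw [h1, mul_zero]
    rw [this, h2]; rfl
  · intro f
    obtain ⟨g, r, hg⟩ := DA.divb b f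
    refine ⟨(v * g, r), DA.ext' fun z => ?_⟩
    rw [DA.T_apply, hg z, hu z]
    have e : (v * g).1 z = v.1 z * g.1 z := rfl
    rw [e]
    linear_combination (z : ℂ) ^ b * g.1 z * huv' z


theorem DA.norm_le (f : DA) (C : ℝ) (hC : 0 ≤ C) (h : ∀ z : Dk, ‖f.1 z‖ ≤ C) : ‖f‖ ≤ C :=
  (ContinuousMap.norm_le f.1 hC).2 h

section
variable {E : Type} [NormedAddCommGroup E] [NormedSpace ℂ E]

/-- Scaling in the first variable. -/
noncomputable def sc (z : ℂ) : ℂ × E →L[ℂ] ℂ × E :=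
  (z • ContinuousLinearMap.fst ℂ ℂ E).prod (ContinuousLinearMap.snd ℂ ℂ E)

theorem sc_apply (z : ℂ) (w : ℂ × E) : sc z w = (z * w.1, w.2) := rfl

theorem sc_norm (z : Dk) (w : ℂ × E) : ‖sc (z : ℂ) w‖ ≤ ‖w‖ := by
  have hz : ‖(z : ℂ)‖ ≤ 1 := mem_closedBall_zero_iff.1 z.2
  rw [Prod.norm_def, Prod.norm_def, sc_apply]
  refine max_le_max ?_ le_rfl
  simp only [norm_mul]
  exact mul_le_of_le_one_left (norm_nonneg _) hz

theorem sc_diff {n : ℕ} (p : ContinuousMultilinearMap ℂ (fun _ : Fin n => ℂ × E) ℂ)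
    (e : Fin n → ℂ × E) :
    Differentiable ℂ (fun z => p.compContinuousLinearMap (fun _ => sc z) e) := by
  have h1 : Differentiable ℂ p := (p.contDiff (n := 1)).differentiable (by simp)
  refine h1.comp (differentiable_pi.2 fun i => ?_)
  change Differentiable ℂ (fun x : ℂ => (x * (e i).1, (e i).2))
  fun_prop

/-- Coefficients of the superposition operator, algebraic version. -/
noncomputable def nemM {n : ℕ} (p : ContinuousMultilinearMap ℂ (fun _ : Fin n => ℂ × E) ℂ) :
    MultilinearMap ℂ (fun _ : Fin n => ℂ × E) DA where
  toFun e := DA.mk' (fun z => p.compContinuousLinearMap (fun _ => sc z) e)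
        (sc_diff p e).continuous.continuousOn (sc_diff p e).differentiableOn
  map_update_add' := fun m i x y => DA.ext' fun z =>
    (p.compContinuousLinearMap (fun _ => sc z)).map_update_add m i x y
  map_update_smul' := fun m i c x => DA.ext' fun z =>
    (p.compContinuousLinearMap (fun _ => sc z)).map_update_smul m i c x

theorem nemM_apply {n : ℕ} (p : ContinuousMultilinearMap ℂ (fun _ : Fin n => ℂ × E) ℂ)
    (e : Fin n → ℂ × E) (z : Dk) : (nemM p e).1 z = p (fun i => sc z (e i)) := rfl

theorem nemM_norm {n : ℕ} (p : ContinuousMultilinearMap ℂ (fun _ : Fin n => ℂ × E) ℂ)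
    (e : Fin n → ℂ × E) : ‖nemM p e‖ ≤ ‖p‖ * ∏ i, ‖e i‖ := by
  refine DA.norm_le _ _ (by positivity) fun z => ?_
  rw [nemM_apply]
  refine (p.le_opNorm _).trans ?_
  gcongr
  exact sc_norm z _

/-- Coefficients of the superposition operator. -/
noncomputable def nemC {n : ℕ} (p : ContinuousMultilinearMap ℂ (fun _ : Fin n => ℂ × E) ℂ) :
    ContinuousMultilinearMap ℂ (fun _ : Fin n => ℂ × E) DA :=
  MultilinearMap.mkContinuous (nemM p) ‖p‖ (nemM_norm p)
  
theorem nemC_apply {n : ℕ} (p : ContinuousMultilinearMap ℂ (fun _ : Fin n => ℂ × E) ℂ)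
    (e : Fin n → ℂ × E) (z : Dk) : (nemC p e).1 z = p (fun i => sc z (e i)) := rfl

theorem nemC_norm {n : ℕ} (p : ContinuousMultilinearMap ℂ (fun _ : Fin n => ℂ × E) ℂ) :
    ‖nemC p‖ ≤ ‖p‖ := MultilinearMap.mkContinuous_norm_le _ (norm_nonneg _) _

/-- Evaluation as a continuous linear map. -/
noncomputable def DA.evL (z : Dk) : DA →L[ℂ] ℂ :=
  LinearMap.mkContinuous 
    { toFun := fun f => f.1 z
      map_add' := fun _ _ => rfl
      map_smul' := fun _ _ => rfl } 1 (fun f => by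
        rw [one_mul]
        exact ContinuousMap.norm_coe_le_norm f.1 z)

theorem nem (h : ℂ × E → ℂ) (p : FormalMultilinearSeries ℂ (ℂ × E) ℂ) (R : ENNReal)
    (hp : HasFPowerSeriesOnBall h p 0 R) : ∃ Ψ : ℂ × E → DA,
      (∀ w ∈ eball (0 : ℂ × E) R, AnalyticAt ℂ Ψ w) ∧
      ∀ w ∈ eball (0 : ℂ × E) R, ∀ z : Dk, (Ψ w).1 z = h (z * w.1, w.2) := by
  let q : FormalMultilinearSeries ℂ (ℂ × E) DA := fun n => nemC (p n)
  have hq : R ≤ q.radius := by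
    refine hp.r_le.trans ?_
    refine ENNReal.le_of_forall_nnreal_lt fun r hr => ?_
    obtain ⟨C, hC, h⟩ := p.norm_mul_pow_le_of_lt_radius hr
    refine q.le_radius_of_bound C fun n => le_trans ?_ (h n)
    gcongr
    exact nemC_norm _
  have hs := q.hasFPowerSeriesOnBall (hp.r_pos.trans_le hq)
  refine ⟨q.sum, fun w hw => hs.analyticAt_of_mem (eball_subset_eball hq hw), fun w hw z => ?_⟩
  have h1 := (hs.mono hp.r_pos hq).hasSum hw
  have h2 := (DA.evL z).hasSum h1
  have hz : sc (z : ℂ) w ∈ eball (0 : ℂ × E) R := by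
    rw [mem_eball, edist_zero_right] at hw ⊢
    refine lt_of_le_of_lt ?_ hw
    exact enorm_le_iff_norm_le.2 (sc_norm z w)
  have h3 := hp.hasSum hz
  rw [zero_add] at h2 h3
  exact h2.unique h3

end


/-- Retraction to the disc. -/
noncomputable def retr (z : ℂ) : Dk := ⟨z / (max 1 ‖z‖ : ℝ), by
  rw [mem_closedBall_zero_iff, norm_div, Complex.norm_real, Real.norm_eq_abs,
    abs_of_pos (lt_max_of_lt_left one_pos), div_le_one (lt_max_of_lt_left one_pos)]
  exact le_max_right _ _⟩

theorem retr_cont : Continuous retr := by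
  refine Continuous.subtype_mk (continuous_id.div ?_ ?_) _
  · exact Complex.continuous_ofReal.comp (continuous_const.max continuous_norm)
  · intro z
    exact_mod_cast (lt_max_of_lt_left one_pos).ne'

theorem retr_of_le (z : ℂ) (h : ‖z‖ ≤ 1) : (retr z : ℂ) = z := by
  simp [retr, max_eq_left h]

theorem banach_solve {E X Y : Type} [NormedAddCommGroup E] [NormedSpace ℂ E]
    [NormedAddCommGroup X] [NormedSpace ℂ X] [CompleteSpace X]
    [NormedAddCommGroup Y] [NormedSpace ℂ Y] [CompleteSpace Y]
    (T : E → (X →L[ℂ] Y)) (F : E → Y) (hT : AnalyticAt ℂ T 0) (hF : AnalyticAt ℂ F 0)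
    (bij : Function.Bijective (T 0)) :
    ∃ sol : E → X, AnalyticAt ℂ sol 0 ∧ ∀ᶠ x in nhds (0 : E), T x (sol x) = F x := by
  let e : X ≃L[ℂ] Y := ContinuousLinearEquiv.ofBijective (T 0)
    (LinearMap.ker_eq_bot.2 bij.1) (LinearMap.range_eq_top.2 bij.2)
  have he : ∀ y, e y = T 0 y := fun y => rfl
  let B : E → (Y →L[ℂ] Y) := fun x => (T x).comp (e.symm : Y →L[ℂ] X)
  have hB : AnalyticAt ℂ B 0 := by
    let L2 : (X →L[ℂ] Y) →L[ℂ] (Y →L[ℂ] Y) :=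
      (ContinuousLinearMap.compL ℂ Y X Y).flip (e.symm : Y →L[ℂ] X)
    exact AnalyticAt.comp (g := L2) (L2.analyticAt _) hT
  have hB0 : B 0 = 1 := by
    ext1 y
    change T 0 (e.symm y) = y
    rw [← he]; simp
  have hBi : AnalyticAt ℂ (fun x => Ring.inverse (B x)) 0 := by
    refine AnalyticAt.comp (g := Ring.inverse) ?_ hB
    rw [hB0]
    exact analyticAt_inverse (1 : (Y →L[ℂ] Y)ˣ)
  have hBu : ∀ᶠ x in nhds (0 : E), IsUnit (B x) := by
    refine hB.continuousAt (Units.isOpen.mem_nhds ?_)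
    rw [hB0]; exact isUnit_one
  refine ⟨fun x => e.symm (Ring.inverse (B x) (F x)), ?_, ?_⟩
  · have h1 : AnalyticAt ℂ (fun x => Ring.inverse (B x) (F x)) 0 := by
      exact AnalyticAt.comp
        (((ContinuousLinearMap.id ℂ (Y →L[ℂ] Y)).analyticAt_bilinear _)) (hBi.prod hF)
    exact AnalyticAt.comp (g := e.symm)
      ((e.symm : Y →L[ℂ] X).analyticAt _) h1
  · filter_upwards [hBu] with x hx
    have : B x * Ring.inverse (B x) = 1 := Ring.mul_inverse_cancel _ hx
    exact congrArg (fun L : Y →L[ℂ] Y => L (F x)) this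

theorem wdiv {E : Type} [NormedAddCommGroup E] [NormedSpace ℂ E]
    (h f : ℂ × E → ℂ) (hh : AnalyticAt ℂ h 0) (hf : AnalyticAt ℂ f 0) (b : ℕ) (u : ℂ → ℂ)
    (hu : AnalyticAt ℂ u 0) (hu0 : u 0 ≠ 0) (hb : ∀ᶠ t in nhds (0 : ℂ), h (t, 0) = t ^ b * u t) :
    ∃ (r : Fin b → E → ℂ) (q : ℂ × E → ℂ), (∀ j, AnalyticAt ℂ (r j) 0) ∧
      (∀ᶠ z in nhds (0 : ℂ × E), ContinuousAt q z) ∧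
      ∀ᶠ z in nhds (0 : ℂ × E), f z = q z * h z + ∑ j, r j z.2 * z.1 ^ (j : ℕ) := by
  obtain ⟨p, R, hp⟩ := hh
  obtain ⟨p', R', hp'⟩ := hf
  obtain ⟨Ψ, hΨ, hΨ'⟩ := nem h p R hp
  obtain ⟨Φ, hΦ, hΦ'⟩ := nem f p' R' hp'
  have ev1 : ∀ᶠ t in nhds (0 : ℂ), (t, (0 : E)) ∈ eball (0 : ℂ × E) (min R R') ∧
      h (t, 0) = t ^ b * u t ∧ u t ≠ 0 ∧ AnalyticAt ℂ u t := by
    refine Eventually.and ?_ (hb.and (Eventually.and ?_ ?_))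
    · have : Tendsto (fun t : ℂ => (t, (0 : E))) (nhds 0) (nhds 0) := by
        have : Continuous (fun t : ℂ => (t, (0 : E))) := by fun_prop
        exact this.tendsto 0
      exact this (eball_mem_nhds _ (lt_min hp.r_pos hp'.r_pos))
    · exact hu.continuousAt.eventually_ne hu0
    · exact hu.eventually_analyticAt
  obtain ⟨s', hs', hs1⟩ := Metric.eventually_nhds_iff_ball.1 ev1
  obtain ⟨s, hs0, hss⟩ : ∃ s : ℝ, 0 < s ∧ s < s' := ⟨s' / 2, by linarith, by linarith⟩
  have hsz : ∀ z : ℂ, ‖z‖ ≤ 1 → (s : ℂ) * z ∈ ball (0 : ℂ) s' := fun z hz => by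
    rw [mem_ball_zero_iff, norm_mul, Complex.norm_real, Real.norm_eq_abs, abs_of_pos hs0]
    nlinarith
  have hsC : (s : ℂ) ≠ 0 := by exact_mod_cast hs0.ne'
  have hsb : ((s : ℂ), (0 : E)) ∈ eball (0 : ℂ × E) (min R R') := by
    simpa using (hs1 _ (hsz 1 (by simp))).1
  -- slices
  let H : E → DA := fun x => Ψ ((s : ℂ), x)
  let F : E → DA := fun x => Φ ((s : ℂ), x)
  have hincl : AnalyticAt ℂ (fun x : E => ((s : ℂ), x)) 0 := analyticAt_const.prod analyticAt_id
  have hH : AnalyticAt ℂ H 0 :=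
    AnalyticAt.comp (g := Ψ) (hΨ _ (eball_subset_eball (min_le_left _ _) hsb)) hincl
  have hF : AnalyticAt ℂ F 0 :=
    AnalyticAt.comp (g := Φ) (hΦ _ (eball_subset_eball (min_le_right _ _) hsb)) hincl
  have hin : ∀ᶠ x in nhds (0 : E), ((s : ℂ), x) ∈ eball (0 : ℂ × E) (min R R') :=
    hincl.continuousAt (isOpen_eball.mem_nhds hsb)
  have hudiff : ∀ z : ℂ, ‖z‖ ≤ 1 → DifferentiableAt ℂ (fun z => u (s * z)) z := fun z hz => by
    have := (hs1 _ (hsz z hz)).2.2.2.differentiableAt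
    exact DifferentiableAt.comp (g := u) z this (by fun_prop)
  have huc : ContinuousOn (fun z => u (s * z)) (closedBall 0 1) := fun z hz =>
    (hudiff z (mem_closedBall_zero_iff.1 hz)).continuousAt.continuousWithinAt
  have hud : DifferentiableOn ℂ (fun z => u (s * z)) (ball 0 1) := fun z hz =>
    (hudiff z (mem_ball_zero_iff.1 hz).le).differentiableWithinAt
  have hune : ∀ z ∈ closedBall (0 : ℂ) 1, (s : ℂ) ^ b * u (s * z) ≠ 0 := fun z hz =>
    mul_ne_zero (pow_ne_zero _ hsC) (hs1 _ (hsz z (mem_closedBall_zero_iff.1 hz))).2.2.1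
  have bij : Function.Bijective (DA.T b (H 0)) := by
    refine DA.T_bij b (H 0)
      (DA.mk' (fun z => (s : ℂ) ^ b * u (s * z)) (continuousOn_const.mul huc) (hud.const_mul _))
      (DA.mk' (fun z => ((s : ℂ) ^ b * u (s * z))⁻¹) ((continuousOn_const.mul huc).inv₀ hune)
        ((hud.const_mul _).inv fun z hz => hune z (ball_subset_closedBall hz))) ?_ ?_
    · refine DA.ext' fun z => ?_
      exact mul_inv_cancel₀ (hune z z.2)
    · intro z
      rw [hΨ' _ (eball_subset_eball (min_le_left _ _) hsb), DA.mk'_apply, mul_comm (z : ℂ) (s : ℂ),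
        (hs1 _ (hsz z (mem_closedBall_zero_iff.1 z.2))).2.1]
      ring
  have hTa : AnalyticAt ℂ (fun x => DA.T b (H x)) 0 :=
      AnalyticAt.comp (g := DA.T b) (DA.T_analytic b _) hH
  obtain ⟨sol, hsol, hsol2⟩ := banach_solve (E := E) (X := DA × (Fin b → ℂ)) (Y := DA)
    (fun x => DA.T b (H x)) F hTa hF bij
  refine ⟨fun j x => (sol x).2 j / (s : ℂ) ^ (j : ℕ), fun z => (sol z.2).1.1 (retr (z.1 / s)),
    fun j => ?_, ?_, ?_⟩
  · have h1 : AnalyticAt ℂ (fun x => (sol x).2) 0 := 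
      AnalyticAt.comp (g := Prod.snd) analyticAt_snd hsol
    have h2 : AnalyticAt ℂ (fun x => (sol x).2 j) 0 := 
      (ContinuousLinearMap.proj (R := ℂ) (φ := fun _ : Fin b => ℂ) j).analyticAt _ |>.comp h1
    exact h2.div_const
  · have : ∀ᶠ z in nhds (0 : ℂ × E), AnalyticAt ℂ sol z.2 :=
      (continuous_snd.tendsto (0 : ℂ × E)).eventually hsol.eventually_analyticAt
    filter_upwards [this] with z hz
    have h1 : ContinuousAt (fun z : ℂ × E => (sol z.2).1.1) z :=
      continuous_subtype_val.continuousAt.comp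
        (continuous_fst.continuousAt.comp (ContinuousAt.comp (g := sol) hz.continuousAt continuousAt_snd))
    have h2 : ContinuousAt (fun z : ℂ × E => retr (z.1 / s)) z :=
      (retr_cont.comp (continuous_fst.div_const _)).continuousAt
    exact h1.eval h2
  · have e1 := (continuous_snd.tendsto (0 : ℂ × E)).eventually (hsol2.and hin)
    have e2 : ∀ᶠ z in nhds (0 : ℂ × E), ‖z.1 / (s : ℂ)‖ ≤ 1 := by
      have : ContinuousAt (fun z : ℂ × E => ‖z.1 / (s : ℂ)‖) 0 := by fun_prop
      have h2 := this.eventually (gt_mem_nhds (show ‖(0 : ℂ × E).1 / (s : ℂ)‖ < 1 by simp))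
      exact h2.mono fun z hz => le_of_lt hz
    filter_upwards [e1, e2] with ⟨t, x⟩ ⟨h1, h2⟩ h3
    have h4 := congrArg (fun f : DA => f.1 (retr (t / s))) h1
    simp only at h4
    rw [← Prod.mk.eta (p := sol x), DA.T_apply, hΨ' _ (eball_subset_eball (min_le_left _ _) h2),
      hΦ' _ (eball_subset_eball (min_le_right _ _) h2), retr_of_le _ h3] at h4
    simp only [div_mul_cancel₀ _ hsC] at h4
    simp only at h3 ⊢
    rw [← h4, mul_comm]
    congr 1
    refine Finset.sum_congr rfl fun j _ => ?_
    rw [div_pow]; ring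


section
variable {K : Type} [Field K] [Algebra ℂ K]

theorem ev_congr {ev : (ℕ → ℂ) →ₐ[ℂ] K} (hev : ∀ a : ℕ → ℂ, (∀ᶠ n in atTop, a n = 0) → ev a = 0)
    {a b : ℕ → ℂ} (h : ∀ᶠ n in atTop, a n = b n) : ev a = ev b := by
  rw [← sub_eq_zero, ← map_sub]
  exact hev _ (h.mono fun n hn => by simp [hn])

theorem ev_congr_of {ev : (ℕ → ℂ) →ₐ[ℂ] K}
    (hev : ∀ a : ℕ → ℂ, (∀ᶠ n in atTop, a n = 0) → ev a = 0)
    {a b h : ℕ → ℂ} (h0 : ev h = 0) (H : ∀ᶠ n in atTop, h n = 0 → a n = b n) : ev a = ev b := by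
  have : ev a = ev (b + (fun n => (a n - b n) / h n) * h) := by
    refine ev_congr hev (H.mono fun n hn => ?_)
    by_cases h1 : h n = 0
    · simp [h1, hn h1]
    · simp [h1]
  rw [this, map_add, map_mul, h0, mul_zero, add_zero]

theorem ev_ne_zero {ev : (ℕ → ℂ) →ₐ[ℂ] K}
    (hev : ∀ a : ℕ → ℂ, (∀ᶠ n in atTop, a n = 0) → ev a = 0)
    {a : ℕ → ℂ} (h : ∀ᶠ n in atTop, a n ≠ 0) : ev a ≠ 0 := by
  intro h0
  have := ev_congr_of hev (a := 1) (b := 0) h0 (h.mono fun n hn h' => absurd h' hn)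
  simp at this

theorem mem_range_of_alg {a : K} (h : IsAlgebraic ℂ a) : ∃ c : ℂ, algebraMap ℂ K c = a := by
  have h1 := minpoly.irreducible h.isIntegral
  have h2 := IsAlgClosed.degree_eq_one_of_irreducible ℂ h1
  exact minpoly.mem_range_of_degree_eq_one ℂ a h2

theorem alg_trans (S S' : Subalgebra ℂ K) (h : ∀ x ∈ S', IsIntegral S x) (a : K)
    (ha : IsAlgebraic S' a) : IsAlgebraic S a := by
  have h2 : IsAlgebraic (integralClosure S K) a := by
    obtain ⟨p, hp0, hp⟩ := ha
    let φ : S' →+* integralClosure S K := 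
      { toFun := fun x => ⟨x.1, h x.1 x.2⟩
        map_one' := rfl
        map_zero' := rfl
        map_add' := fun _ _ => rfl
        map_mul' := fun _ _ => rfl }
    refine ⟨p.map φ, ?_, ?_⟩
    · rw [Ne, Polynomial.map_eq_zero_iff]
      · exact hp0
      · intro x y hxy
        exact Subtype.ext (congrArg (fun z : integralClosure S K => z.1) hxy)
    · rw [Polynomial.aeval_def, Polynomial.eval₂_map, ← hp, Polynomial.aeval_def]
      rfl
  exact h2.restrictScalars S

variable {E : Type} [NormedAddCommGroup E] [NormedSpace ℂ E]

/-- Values of analytic germs. -/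
def Aev (ev : (ℕ → ℂ) →ₐ[ℂ] K) (y : ℕ → E) : Subalgebra ℂ K where
  carrier := {a | ∃ h : E → ℂ, AnalyticAt ℂ h 0 ∧ ev (fun n => h (y n)) = a}
  mul_mem' := by
    rintro _ _ ⟨f, hf, rfl⟩ ⟨g, hg, rfl⟩
    exact ⟨fun z => f z * g z, hf.mul hg, by rw [← map_mul]; rfl⟩
  add_mem' := by
    rintro _ _ ⟨f, hf, rfl⟩ ⟨g, hg, rfl⟩
    exact ⟨fun z => f z + g z, hf.add hg, by rw [← map_add]; rfl⟩
  algebraMap_mem' := fun c => ⟨fun _ => c, analyticAt_const, ev.commutes c⟩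

/-- Derivations satisfying the chain rule. -/
def Der (ev : (ℕ → ℂ) →ₐ[ℂ] K) (y : ℕ → E) (D : Derivation ℂ K K) : Prop :=
  ∃ (k : ℕ) (c : Fin k → K) (v : Fin k → E), ∀ h : E → ℂ, AnalyticAt ℂ h 0 →
    D (ev (fun n => h (y n))) = ∑ i, c i * ev (fun n => fderiv ℂ h (y n) (v i))

theorem an_fderiv {h : E → ℂ} {x : E} (hh : AnalyticAt ℂ h x) (v : E) :
    AnalyticAt ℂ (fun z => fderiv ℂ h z v) x :=
  ((ContinuousLinearMap.apply ℂ ℂ v).analyticAt _).comp hh.fderiv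

theorem const_quot (u w : E → ℂ) (hu : AnalyticAt ℂ u 0) (hw : AnalyticAt ℂ w 0)
    (hw0 : ¬ ∀ᶠ z in nhds 0, w z = 0)
    (h : ∀ v, ∀ᶠ z in nhds 0, w z * fderiv ℂ u z v - fderiv ℂ w z v * u z = 0) :
    ∃ c : ℂ, ∀ᶠ z in nhds 0, u z = c * w z := by
  obtain ⟨ε, hε, hball⟩ := Metric.eventually_nhds_iff_ball.1
    (hu.eventually_analyticAt.and hw.eventually_analyticAt)
  have hpc : IsPreconnected (ball (0 : E) ε) := (convex_ball _ _).isPreconnected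
  have h0 : (0 : E) ∈ ball (0 : E) ε := mem_ball_self hε
  have key : ∀ v, ∀ z ∈ ball (0 : E) ε, w z * fderiv ℂ u z v - fderiv ℂ w z v * u z = 0 := by
    intro v
    have hA : AnalyticOnNhd ℂ (fun z => w z * fderiv ℂ u z v - fderiv ℂ w z v * u z)
        (ball (0 : E) ε) := fun z hz => by
      obtain ⟨h1, h2⟩ := hball z hz
      exact (h2.mul (an_fderiv h1 v)).sub ((an_fderiv h2 v).mul h1)
    exact hA.eqOn_zero_of_preconnected_of_eventuallyEq_zero hpc h0 (h v)
  obtain ⟨p, hp, hwp⟩ : ∃ p ∈ ball (0 : E) ε, w p ≠ 0 := by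
    by_contra hcon
    push Not at hcon
    exact hw0 (eventually_of_mem (ball_mem_nhds _ hε) hcon)
  have ev1 : ∀ᶠ z in nhds p, z ∈ ball (0 : E) ε ∧ w z ≠ 0 :=
    Filter.Eventually.and (isOpen_ball.mem_nhds hp)
      ((hball p hp).2.continuousAt.eventually_ne hwp)
  obtain ⟨δ, hδ, hball2⟩ := Metric.eventually_nhds_iff_ball.1 ev1
  have hcst : ∀ z ∈ ball p δ, u z / w z = u p / w p := by
    intro z hz
    refine (isOpen_ball : IsOpen (ball p δ)).is_const_of_fderiv_eq_zero (𝕜 := ℂ) 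
      (f := fun z => u z / w z) (convex_ball _ _).isPreconnected
      ?_ ?_ hz (mem_ball_self hδ)
    · intro z hz
      obtain ⟨h1, h2⟩ := hball2 z hz
      exact ((hball z h1).1.div (hball z h1).2 h2).differentiableAt.differentiableWithinAt
    · intro z hz
      obtain ⟨h1, h2⟩ := hball2 z hz
      have hd1 := (hball z h1).1.differentiableAt
      have hd2 := (hball z h1).2.differentiableAt
      ext v
      have hd3 : DifferentiableAt ℂ (fun z => u z / w z) z :=
        ((hball z h1).1.div (hball z h1).2 h2).differentiableAt
      have hq := hd3.hasFDerivAt.mul hd2.hasFDerivAt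
      have heq : (fun z => u z / w z) * w =ᶠ[nhds z] u := by
        filter_upwards [hd2.continuousAt.eventually_ne h2] with t ht
        simp [ht]
      have hu' := (hq.congr_of_eventuallyEq heq.symm).unique hd1.hasFDerivAt
      have hv := congrArg (fun L : E →L[ℂ] ℂ => L v) hu'
      have hk := key v z h1
      simp only [_root_.add_apply, _root_.smul_apply, smul_eq_mul] at hv
      rw [← hv] at hk
      field_simp at hk
      have h3 : w z * w z * fderiv ℂ (fun z => u z / w z) z v = 0 := by
        linear_combination hk
      simpa [h2] using h3
  refine ⟨u p / w p, ?_⟩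
  have hA : AnalyticOnNhd ℂ (fun z => u z - u p / w p * w z) (ball (0 : E) ε) := fun z hz =>
    (hball z hz).1.sub (analyticAt_const.mul (hball z hz).2)
  have := hA.eqOn_zero_of_preconnected_of_eventuallyEq_zero hpc hp (by
    filter_upwards [ball_mem_nhds p hδ] with z hz
    have := hcst z hz
    have h2 := (hball2 z hz).2
    rw [← this]
    simp [h2])
  filter_upwards [ball_mem_nhds _ hε] with z hz
  have := this hz
  simpa [sub_eq_zero] using this

end


section
variable {K : Type} [Field K] [Algebra ℂ K]
variable {E : Type} [NormedAddCommGroup E] [NormedSpace ℂ E]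

theorem exists_dv {ev : (ℕ → ℂ) →ₐ[ℂ] K}
    (hev : ∀ a : ℕ → ℂ, (∀ᶠ n in atTop, a n = 0) → ev a = 0)
    (y : ℕ → E) (hy : Tendsto y atTop (nhds 0))
    (hinj : ∀ h : E → ℂ, AnalyticAt ℂ h 0 → ev (fun n => h (y n)) = 0 → ∀ᶠ z in nhds 0, h z = 0)
    (v : E) : ∃ D : Derivation ℂ K K, ∀ h : E → ℂ, AnalyticAt ℂ h 0 →
      D (ev (fun n => h (y n))) = ev (fun n => fderiv ℂ h (y n) v) := by
  have hx : ∀ x : Aev ev y, ∃ h : E → ℂ, AnalyticAt ℂ h 0 ∧ ev (fun n => h (y n)) = (x : K) :=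
    fun x => x.2
  choose rep hrep1 hrep2 using hx
  let d : Aev ev y → K := fun x => ev (fun n => fderiv ℂ (rep x) (y n) v)
  have hd : ∀ (x : Aev ev y) (h : E → ℂ), AnalyticAt ℂ h 0 → ev (fun n => h (y n)) = (x : K) →
      d x = ev (fun n => fderiv ℂ h (y n) v) := by
    intro x h hh hhx
    have h0 : ∀ᶠ z in nhds 0, rep x z - h z = 0 := by
      refine hinj (fun z => rep x z - h z) ((hrep1 x).sub hh) ?_
      have : (fun n => rep x (y n) - h (y n)) = (fun n => rep x (y n)) - fun n => h (y n) := rfl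
      rw [this, map_sub, hrep2, hhx, sub_self]
    have h1 : rep x =ᶠ[nhds 0] h := h0.mono fun z hz => sub_eq_zero.1 hz
    refine ev_congr hev ((hy.eventually (h1.fderiv (𝕜 := ℂ))).mono fun n hn => ?_)
    rw [hn]
  have hdan : ∀ (h : E → ℂ), AnalyticAt ℂ h 0 → ∀ᶠ n in atTop, DifferentiableAt ℂ h (y n) :=
    fun h hh => hy.eventually (hh.eventually_analyticAt.mono fun z hz => hz.differentiableAt)
  let dl : Aev ev y →ₗ[ℂ] K :=
    { toFun := d
      map_add' := by
        intro a b
        rw [hd (a + b) (fun z => rep a z + rep b z) ((hrep1 a).add (hrep1 b))]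
        · change _ = ev _ + ev _
          rw [← map_add]
          refine ev_congr hev ?_
          filter_upwards [hdan _ (hrep1 a), hdan _ (hrep1 b)] with n h1 h2
          rw [fderiv_fun_add h1 h2]
          rfl
        · change _ = (a : K) + b
          rw [← hrep2 a, ← hrep2 b, ← map_add]
          rfl
      map_smul' := by
        intro c a
        rw [hd (c • a) (fun z => c • rep a z) (analyticAt_const.mul (hrep1 a))]
        · change _ = c • ev _
          rw [← map_smul]
          refine ev_congr hev ?_
          filter_upwards [hdan _ (hrep1 a)] with n h1
          rw [fderiv_fun_const_smul h1]
          rfl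
        · change _ = c • (a : K)
          rw [← hrep2 a, ← map_smul]
          rfl }
  have hleib : ∀ a b : Aev ev y, dl (a * b) = a • dl b + b • dl a := by
    intro a b
    change d (a * b) = (a : K) * d b + (b : K) * d a
    rw [hd (a * b) (fun z => rep a z * rep b z) ((hrep1 a).mul (hrep1 b))]
    · change _ = _ * ev _ + _ * ev _
      rw [← hrep2 a, ← hrep2 b, ← map_mul, ← map_mul, ← map_add]
      refine ev_congr hev ?_
      filter_upwards [hdan _ (hrep1 a), hdan _ (hrep1 b)] with n h1 h2
      rw [fderiv_fun_mul h1 h2]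
      rfl
    · change _ = (a : K) * b
      rw [← hrep2 a, ← hrep2 b, ← map_mul]
      rfl
  have : CharZero K := charZero_of_injective_algebraMap (algebraMap ℂ K).injective
  obtain ⟨D', hD'⟩ := ext_deriv (Aev ev y) K (Derivation.mk' dl hleib)
  refine ⟨D', fun h hh => ?_⟩
  have := hD' ⟨ev (fun n => h (y n)), h, hh, rfl⟩
  rw [← hd ⟨ev (fun n => h (y n)), h, hh, rfl⟩ h hh rfl]
  exact this

theorem inj_case {ev : (ℕ → ℂ) →ₐ[ℂ] K}
    (hev : ∀ a : ℕ → ℂ, (∀ᶠ n in atTop, a n = 0) → ev a = 0)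
    (y : ℕ → E) (hy : Tendsto y atTop (nhds 0))
    (hinj : ∀ h : E → ℂ, AnalyticAt ℂ h 0 → ev (fun n => h (y n)) = 0 → ∀ᶠ z in nhds 0, h z = 0)
    (a : K) (ha : IsAlgebraic (Aev ev y) a) (hD : ∀ D, Der ev y D → D a = 0) :
    ∃ c : ℂ, algebraMap ℂ K c = a := by
  classical
  -- minimal vanishing tuple
  have hex : ∃ n : ℕ, ∃ u : ℕ → E → ℂ, (∀ i, AnalyticAt ℂ (u i) 0) ∧
      (ev (fun k => u n (y k)) ≠ 0) ∧
      ∑ i ∈ Finset.range (n + 1), ev (fun k => u i (y k)) * a ^ i = 0 := by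
    obtain ⟨p, hp0, hp⟩ := ha
    have hx : ∀ x : Aev ev y, ∃ h : E → ℂ, AnalyticAt ℂ h 0 ∧ ev (fun n => h (y n)) = (x : K) :=
      fun x => x.2
    choose rep hrep1 hrep2 using hx
    refine ⟨p.natDegree, fun i => rep (p.coeff i), fun i => hrep1 _, ?_, ?_⟩
    · rw [hrep2]
      have := Polynomial.leadingCoeff_ne_zero.2 hp0
      intro h
      exact this (Subtype.ext h)
    · simp_rw [hrep2]
      rw [Polynomial.aeval_eq_sum_range] at hp
      exact hp
  obtain ⟨u, hu, hun, hsum⟩ := Nat.find_spec hex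
  set n := Nat.find hex with hn
  have hmin := fun m (hm : m < n) => Nat.find_min hex hm
  have hnz : ¬ ∀ᶠ z in nhds 0, u n z = 0 := by
    intro h
    exact hun (hev _ (hy.eventually h))
  -- any shorter relation is trivial
  have htriv : ∀ w : ℕ → E → ℂ, (∀ i, AnalyticAt ℂ (w i) 0) →
      ∑ i ∈ Finset.range n, ev (fun k => w i (y k)) * a ^ i = 0 →
      ∀ i < n, ev (fun k => w i (y k)) = 0 := by
    intro w hw hs
    by_contra hcon
    push Not at hcon
    -- largest index
    have hne : ((Finset.range n).filter fun i => ev (fun k => w i (y k)) ≠ 0).Nonempty := by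
      obtain ⟨i, hi, hi'⟩ := hcon
      exact ⟨i, by simp [hi, hi']⟩
    set m := Finset.max' _ hne with hm
    have hmm := Finset.max'_mem _ hne
    rw [← hm, Finset.mem_filter, Finset.mem_range] at hmm
    refine hmin m hmm.1 ⟨w, hw, hmm.2, ?_⟩
    rw [← hs]
    refine Finset.sum_subset (by
      intro i hi
      rw [Finset.mem_range] at hi ⊢
      omega) ?_
    intro i hi hi'
    rw [Finset.mem_range] at hi hi'
    have : ev (fun k => w i (y k)) = 0 := by
      by_contra h
      have := Finset.le_max' _ i (by simp [hi, h] :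
        i ∈ (Finset.range n).filter fun i => ev (fun k => w i (y k)) ≠ 0)
      omega
    rw [this, zero_mul]
  have hquot : ∀ i < n, ∃ c : ℂ, ∀ᶠ z in nhds 0, u i z = c * u n z := by
    intro i hi
    refine const_quot (u i) (u n) (hu i) (hu n) hnz fun v => ?_
    obtain ⟨D, hDv⟩ := exists_dv hev y hy hinj v
    have hDa : D a = 0 := hD D ⟨1, fun _ => 1, fun _ => v, fun h hh => by simp [hDv h hh]⟩
    refine hinj _ (((hu n).mul (an_fderiv (hu i) v)).sub ((an_fderiv (hu n) v).mul (hu i))) ?_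
    refine htriv (fun i z => u n z * fderiv ℂ (u i) z v - fderiv ℂ (u n) z v * u i z) 
      (fun i => ((hu n).mul (an_fderiv (hu i) v)).sub ((an_fderiv (hu n) v).mul (hu i))) ?_ i hi
    have e1 : ∀ i, ev (fun k => u n (y k) * fderiv ℂ (u i) (y k) v
          - fderiv ℂ (u n) (y k) v * u i (y k)) =
        ev (fun k => u n (y k)) * D (ev (fun k => u i (y k))) -
          D (ev (fun k => u n (y k))) * ev (fun k => u i (y k)) := by
      intro i
      rw [hDv _ (hu i), hDv _ (hu n), ← map_mul, ← map_mul, ← map_sub]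
      rfl
    simp_rw [e1]
    have e2 := congrArg D hsum
    rw [map_zero, map_sum] at e2
    have e3 : ∀ i, D (ev (fun k => u i (y k)) * a ^ i) = D (ev (fun k => u i (y k))) * a ^ i := by
      intro i
      rw [Derivation.leibniz, Derivation.leibniz_pow, hDa]
      simp [mul_comm]
    simp_rw [e3] at e2
    rw [Finset.sum_range_succ] at e2 hsum
    have : ∑ i ∈ Finset.range n, (ev (fun k => u n (y k)) * D (ev (fun k => u i (y k))) -
          D (ev (fun k => u n (y k))) * ev (fun k => u i (y k))) * a ^ i =
        ev (fun k => u n (y k)) * ∑ i ∈ Finset.range n, D (ev (fun k => u i (y k))) * a ^ i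
        - D (ev (fun k => u n (y k))) * ∑ i ∈ Finset.range n, ev (fun k => u i (y k)) * a ^ i := by
      rw [Finset.mul_sum, Finset.mul_sum, ← Finset.sum_sub_distrib]
      exact Finset.sum_congr rfl fun i _ => by ring
    rw [this]
    linear_combination ev (fun k => u n (y k)) * e2 - D (ev (fun k => u n (y k))) * hsum
  choose! c hc using hquot
  apply mem_range_of_alg
  refine ⟨Polynomial.X ^ n + ∑ i ∈ Finset.range n, Polynomial.C (c i) * Polynomial.X ^ i, ?_, ?_⟩
  · apply Polynomial.Monic.ne_zero
    apply Polynomial.monic_X_pow_add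
    refine (Polynomial.degree_sum_le _ _).trans_lt ?_
    rw [Finset.sup_lt_iff (by exact WithBot.bot_lt_coe n)]
    intro i hi
    refine (Polynomial.degree_C_mul_X_pow_le _ _).trans_lt ?_
    exact_mod_cast Finset.mem_range.1 hi
  · have e1 : ∀ i < n, ev (fun k => u i (y k)) = algebraMap ℂ K (c i) * ev (fun k => u n (y k)) := by
      intro i hi
      rw [← Algebra.smul_def, ← map_smul]
      exact ev_congr hev ((hy.eventually (hc i hi)).mono fun k hk => by simpa using hk)
    rw [Finset.sum_range_succ] at hsum
    simp only [map_add, map_sum, map_mul, map_pow, Polynomial.aeval_X, Polynomial.aeval_C]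
    refine (mul_eq_zero.1 (?_ : ev (fun k => u n (y k)) * _ = 0)).resolve_left hun
    rw [← hsum, mul_add, Finset.mul_sum, add_comm]
    congr 1
    refine Finset.sum_congr rfl fun i hi => ?_
    rw [e1 i (Finset.mem_range.1 hi)]
    ring

end


section
variable {K : Type} [Field K] [Algebra ℂ K]
variable {E : Type} [NormedAddCommGroup E] [NormedSpace ℂ E]

/-- Formal first-order operator along the sequence. -/
noncomputable def dsum (ev : (ℕ → ℂ) →ₐ[ℂ] K) (y : ℕ → E) {k : ℕ} (c : Fin k → K) (v : Fin k → E)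
    (f : E → ℂ) : K := ∑ i, c i * ev (fun n => fderiv ℂ f (y n) (v i))

theorem dsum_congr_of {ev : (ℕ → ℂ) →ₐ[ℂ] K}
    (hev : ∀ a : ℕ → ℂ, (∀ᶠ n in atTop, a n = 0) → ev a = 0)
    (y : ℕ → E) (hy : Tendsto y atTop (nhds 0)) {k : ℕ} (c : Fin k → K) (v : Fin k → E)
    (h f g : E → ℂ) (q : E → ℂ) (h0 : ev (fun n => h (y n)) = 0)
    (H : ∀ᶠ z in nhds 0, h z = 0 → fderiv ℂ f z = q z • fderiv ℂ h z + fderiv ℂ g z) :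
    dsum ev y c v f = ev (fun n => q (y n)) * dsum ev y c v h + dsum ev y c v g := by
  unfold dsum
  rw [Finset.mul_sum, ← Finset.sum_add_distrib]
  refine Finset.sum_congr rfl fun i _ => ?_
  have : ev (fun n => fderiv ℂ f (y n) (v i)) =
      ev ((fun n => q (y n)) * (fun n => fderiv ℂ h (y n) (v i)) + fun n => fderiv ℂ g (y n) (v i)) :=
    ev_congr_of hev h0 ((hy.eventually H).mono fun n hn hn' => by
      rw [hn hn']; rfl)
  rw [this, map_add, map_mul]
  ring

theorem dsum_add {ev : (ℕ → ℂ) →ₐ[ℂ] K}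
    (hev : ∀ a : ℕ → ℂ, (∀ᶠ n in atTop, a n = 0) → ev a = 0)
    (y : ℕ → E) (hy : Tendsto y atTop (nhds 0)) {k : ℕ} (c : Fin k → K) (v : Fin k → E)
    (f g : E → ℂ) (hf : AnalyticAt ℂ f 0) (hg : AnalyticAt ℂ g 0) :
    dsum ev y c v (fun z => f z + g z) = dsum ev y c v f + dsum ev y c v g := by
  unfold dsum
  rw [← Finset.sum_add_distrib]
  refine Finset.sum_congr rfl fun i _ => ?_
  rw [← mul_add, ← map_add]
  congr 1
  refine ev_congr hev ?_
  filter_upwards [hy.eventually hf.eventually_analyticAt, hy.eventually hg.eventually_analyticAt]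
    with n h1 h2
  rw [fderiv_fun_add h1.differentiableAt h2.differentiableAt]
  rfl

theorem dsum_mul {ev : (ℕ → ℂ) →ₐ[ℂ] K}
    (hev : ∀ a : ℕ → ℂ, (∀ᶠ n in atTop, a n = 0) → ev a = 0)
    (y : ℕ → E) (hy : Tendsto y atTop (nhds 0)) {k : ℕ} (c : Fin k → K) (v : Fin k → E)
    (f g : E → ℂ) (hf : AnalyticAt ℂ f 0) (hg : AnalyticAt ℂ g 0) :
    dsum ev y c v (fun z => f z * g z) = ev (fun n => f (y n)) * dsum ev y c v g
      + ev (fun n => g (y n)) * dsum ev y c v f := by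
  unfold dsum
  rw [Finset.mul_sum, Finset.mul_sum, ← Finset.sum_add_distrib]
  refine Finset.sum_congr rfl fun i _ => ?_
  have : ev (fun n => fderiv ℂ (fun z => f z * g z) (y n) (v i)) =
      ev ((fun n => f (y n)) * (fun n => fderiv ℂ g (y n) (v i)) +
        (fun n => g (y n)) * fun n => fderiv ℂ f (y n) (v i)) := by
    refine ev_congr hev ?_
    filter_upwards [hy.eventually hf.eventually_analyticAt,
      hy.eventually hg.eventually_analyticAt] with n h1 h2
    rw [fderiv_fun_mul h1.differentiableAt h2.differentiableAt]
    rfl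
  rw [this, map_add, map_mul, map_mul]
  ring

/-- The chain rule holds for `f`. -/
def Good (ev : (ℕ → ℂ) →ₐ[ℂ] K) (y : ℕ → E) {k : ℕ} (c : Fin k → K) (v : Fin k → E)
    (D : Derivation ℂ K K) (f : E → ℂ) : Prop :=
  AnalyticAt ℂ f 0 ∧ D (ev (fun n => f (y n))) = dsum ev y c v f

section

theorem Good.mul {ev : (ℕ → ℂ) →ₐ[ℂ] K}
    (hev : ∀ a : ℕ → ℂ, (∀ᶠ n in atTop, a n = 0) → ev a = 0)
    (y : ℕ → E) (hy : Tendsto y atTop (nhds 0)) {k : ℕ} (c : Fin k → K) (v : Fin k → E)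
    (D : Derivation ℂ K K)
    {f g : E → ℂ} (hf : Good ev y c v D f) (hg : Good ev y c v D g) :
    Good ev y c v D (fun z => f z * g z) := by
  refine ⟨hf.1.mul hg.1, ?_⟩
  rw [dsum_mul hev y hy c v f g hf.1 hg.1, ← hf.2, ← hg.2]
  have : (fun n => f (y n) * g (y n)) = (fun n => f (y n)) * fun n => g (y n) := rfl
  rw [this, map_mul, Derivation.leibniz]
  rfl

theorem Good.add {ev : (ℕ → ℂ) →ₐ[ℂ] K}
    (hev : ∀ a : ℕ → ℂ, (∀ᶠ n in atTop, a n = 0) → ev a = 0)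
    (y : ℕ → E) (hy : Tendsto y atTop (nhds 0)) {k : ℕ} (c : Fin k → K) (v : Fin k → E)
    (D : Derivation ℂ K K)
    {f g : E → ℂ} (hf : Good ev y c v D f) (hg : Good ev y c v D g) :
    Good ev y c v D (fun z => f z + g z) := by
  refine ⟨hf.1.add hg.1, ?_⟩
  rw [dsum_add hev y hy c v f g hf.1 hg.1, ← hf.2, ← hg.2]
  have : (fun n => f (y n) + g (y n)) = (fun n => f (y n)) + fun n => g (y n) := rfl
  rw [this, map_add, map_add]

theorem Good.const {ev : (ℕ → ℂ) →ₐ[ℂ] K} (y : ℕ → E) {k : ℕ}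
    (c : Fin k → K) (v : Fin k → E) (D : Derivation ℂ K K) (a : ℂ) : Good ev y c v D (fun _ => a) := by
  refine ⟨analyticAt_const, ?_⟩
  have : ev (fun _ => a) = algebraMap ℂ K a := ev.commutes a
  have h0 : ev (fun _ : ℕ => (0 : ℂ)) = 0 := map_zero ev
  simp [dsum, this, h0]

theorem Good.pow {ev : (ℕ → ℂ) →ₐ[ℂ] K}
    (hev : ∀ a : ℕ → ℂ, (∀ᶠ n in atTop, a n = 0) → ev a = 0)
    (y : ℕ → E) (hy : Tendsto y atTop (nhds 0)) {k : ℕ} (c : Fin k → K) (v : Fin k → E)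
    (D : Derivation ℂ K K)
    {f : E → ℂ} (hf : Good ev y c v D f) (m : ℕ) :
    Good ev y c v D (fun z => f z ^ m) := by
  induction m with
  | zero => simpa using Good.const (ev := ev) y c v D 1
  | succ m ih => simpa only [pow_succ] using ih.mul hev y hy c v D hf

theorem Good.sum {ev : (ℕ → ℂ) →ₐ[ℂ] K}
    (hev : ∀ a : ℕ → ℂ, (∀ᶠ n in atTop, a n = 0) → ev a = 0)
    (y : ℕ → E) (hy : Tendsto y atTop (nhds 0)) {k : ℕ} (c : Fin k → K) (v : Fin k → E)
    (D : Derivation ℂ K K)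
    {ι : Type} (s : Finset ι) (f : ι → E → ℂ) (hf : ∀ i, Good ev y c v D (f i)) :
    Good ev y c v D (fun z => ∑ i ∈ s, f i z) := by
  classical
  induction s using Finset.induction_on with
  | empty => simpa using Good.const (ev := ev) y c v D 0
  | insert i s hi ih =>
    simp only [Finset.sum_insert hi]
    exact (hf i).add hev y hy c v D ih
end

theorem fderiv_mul_zero {q h g : E → ℂ} {z : E} (hq : ContinuousAt q z)
    (hh : DifferentiableAt ℂ h z) (hg : DifferentiableAt ℂ g z) (h0 : h z = 0) :
    fderiv ℂ (fun z => q z * h z + g z) z = q z • fderiv ℂ h z + fderiv ℂ g z := by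
  have h1 : HasFDerivAt (fun z => q z * h z) (q z • fderiv ℂ h z) z := by
    have hh' := hh.hasFDerivAt
    rw [hasFDerivAt_iff_isLittleO] at hh' ⊢
    have e1 : (fun x => (q x - q z) * (h x - h z)) =o[nhds z] fun x => x - z := by
      have a1 : (fun x => q x - q z) =o[nhds z] (fun _ => (1 : ℝ)) := by
        rw [Asymptotics.isLittleO_one_iff]
        have := hq.tendsto.sub_const (q z)
        simpa using this
      have a2 : (fun x => h x - h z) =O[nhds z] fun x => ‖x - z‖ :=
        (hh.hasFDerivAt.isBigO_sub).norm_right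
      have := a1.mul_isBigO a2
      simp only [one_mul] at this
      exact this.of_norm_right
    have e2 := (hh'.const_mul_left (q z)).add e1
    refine e2.congr_left fun x => ?_
    simp [h0]
    ring
  exact (h1.add hg.hasFDerivAt).fderiv

theorem poly_contra (b : ℕ) (r : Fin b → ℂ) (s : ℂ → ℂ) (hs : Tendsto s (nhds 0) (nhds 0))
    (h : ∀ᶠ t in nhds (0 : ℂ), t ^ b = s t * t ^ b + ∑ j, r j * t ^ (j : ℕ)) : False := by
  set P : Polynomial ℂ := Polynomial.X ^ b - ∑ j, Polynomial.C (r j) * Polynomial.X ^ (j : ℕ) with hP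
  have hdeg : (∑ j, Polynomial.C (r j) * Polynomial.X ^ (j : ℕ) : Polynomial ℂ).degree < b := by
    refine (Polynomial.degree_sum_le _ _).trans_lt ?_
    rw [Finset.sup_lt_iff (by exact WithBot.bot_lt_coe b)]
    intro i hi
    refine (Polynomial.degree_C_mul_X_pow_le _ _).trans_lt ?_
    exact_mod_cast i.2
  have hm : P.Monic := Polynomial.monic_X_pow_sub hdeg
  have hnd : P.natDegree = b := by
    apply Polynomial.natDegree_eq_of_degree_eq_some
    rw [hP, Polynomial.degree_sub_eq_left_of_degree_lt, Polynomial.degree_X_pow]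
    rwa [Polynomial.degree_X_pow]
  obtain ⟨Q, hQ, hQ0⟩ := Polynomial.exists_eq_pow_rootMultiplicity_mul_and_not_dvd P hm.ne_zero 0
  rw [Polynomial.C_0, sub_zero] at hQ hQ0
  set m := P.rootMultiplicity 0
  have hmb : m ≤ b := by
    rw [← hnd]
    exact Polynomial.natDegree_le_of_dvd ⟨Q, hQ⟩ hm.ne_zero |>.trans' (by simp)
  rw [Polynomial.X_dvd_iff, Polynomial.coeff_zero_eq_eval_zero] at hQ0
  apply hQ0
  have h1 : ∀ᶠ t in nhdsWithin (0 : ℂ) {0}ᶜ, Q.eval t = s t * t ^ (b - m) := by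
    filter_upwards [h.filter_mono nhdsWithin_le_nhds, self_mem_nhdsWithin] with t ht ht0
    have ht0 : t ≠ 0 := ht0
    have e1 := congrArg (Polynomial.eval t) hQ
    rw [hP] at e1
    simp only [Polynomial.eval_sub, Polynomial.eval_pow, Polynomial.eval_X,
      Polynomial.eval_finsetSum, Polynomial.eval_mul, Polynomial.eval_C] at e1
    have hp : t ^ b = t ^ m * t ^ (b - m) := by rw [← pow_add]; congr 1; omega
    have : t ^ m * Q.eval t = t ^ m * (s t * t ^ (b - m)) := by
      rw [← e1, ht]
      rw [add_sub_cancel_right, hp]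
      ring
    exact mul_left_cancel₀ (pow_ne_zero _ ht0) this
  have l1 : Tendsto (fun t => Q.eval t) (nhdsWithin (0 : ℂ) {0}ᶜ) (nhds (Q.eval 0)) :=
    (Q.continuous.tendsto 0).mono_left nhdsWithin_le_nhds
  have l2 : Tendsto (fun t : ℂ => s t * t ^ (b - m)) (nhdsWithin (0 : ℂ) {0}ᶜ) (nhds 0) := by
    have := (hs.mul ((continuous_pow (b - m)).tendsto (0 : ℂ))).mono_left
      (nhdsWithin_le_nhds (s := {0}ᶜ))
    simpa using this
  exact tendsto_nhds_unique (l1.congr' h1) l2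
end


section
variable {K : Type} [Field K] [Algebra ℂ K]
variable {E : Type} [NormedAddCommGroup E] [NormedSpace ℂ E]

section

theorem ev_decomp {ev : (ℕ → ℂ) →ₐ[ℂ] K}
    (hev : ∀ a : ℕ → ℂ, (∀ᶠ n in atTop, a n = 0) → ev a = 0)
    (y : ℕ → ℂ × E) (hy : Tendsto y atTop (nhds 0))
    (h : ℂ × E → ℂ) (h0 : ev (fun n => h (y n)) = 0) (b : ℕ)
    (f : ℂ × E → ℂ) (r : Fin b → E → ℂ) (q : ℂ × E → ℂ)
    (hf : ∀ᶠ z in nhds (0:ℂ×E), f z = q z * h z + ∑ j, r j z.2 * z.1 ^ (j:ℕ)) :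
    ev (fun n => f (y n)) =
      ∑ j, ev (fun n => r j (y n).2) * ev (fun n => (y n).1) ^ (j : ℕ) := by
  have : ev (fun n => f (y n)) = ev ((fun n => q (y n)) * (fun n => h (y n)) +
      ∑ j, (fun n => r j (y n).2) * (fun n => (y n).1) ^ (j : ℕ)) :=
    ev_congr hev ((hy.eventually hf).mono fun n hn => by simp [hn])
  rw [this, map_add, map_mul, h0, mul_zero, zero_add, map_sum]
  simp


theorem step_integral {ev : (ℕ → ℂ) →ₐ[ℂ] K}
    (hev : ∀ a : ℕ → ℂ, (∀ᶠ n in atTop, a n = 0) → ev a = 0)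
    (y : ℕ → ℂ × E) (hy : Tendsto y atTop (nhds 0))
    (h : ℂ × E → ℂ) (hh : AnalyticAt ℂ h 0) (h0 : ev (fun n => h (y n)) = 0)
    (b : ℕ) (u : ℂ → ℂ) (hu : AnalyticAt ℂ u 0) (hu0 : u 0 ≠ 0)
    (hb : ∀ᶠ t in nhds (0:ℂ), h (t,0) = t^b * u t)
    (x : K) (hx : x ∈ Aev ev y) :
    IsIntegral (Aev ev (fun n => (y n).2)) x := by
  have hmem : ∀ r : E → ℂ, AnalyticAt ℂ r 0 → 
      ev (fun n => r (y n).2) ∈ Aev ev (fun n => (y n).2) := fun r hr => ⟨r, hr, rfl⟩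
  have hτ : IsIntegral (Aev ev (fun n => (y n).2)) (ev (fun n => (y n).1)) := by
    obtain ⟨r, q, hr, hq, hf⟩ := wdiv h (fun z => z.1 ^ b) hh (analyticAt_fst.pow b) b u hu hu0 hb
    have e := ev_decomp hev y hy h h0 b _ r q hf
    have e' : ev (fun n => (y n).1 ^ b) = ev (fun n => (y n).1) ^ b := by
      rw [← map_pow]; rfl
    rw [e'] at e
    refine ⟨Polynomial.X ^ b - ∑ j, Polynomial.C (⟨_, hmem (r j) (hr j)⟩ : Aev ev (fun n => (y n).2))
      * Polynomial.X ^ (j : ℕ), Polynomial.monic_X_pow_sub ?_, ?_⟩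
    · refine (Polynomial.degree_sum_le _ _).trans_lt ?_
      rw [Finset.sup_lt_iff (by exact WithBot.bot_lt_coe b)]
      intro i hi
      refine (Polynomial.degree_C_mul_X_pow_le _ _).trans_lt ?_
      exact_mod_cast i.2
    · rw [← Polynomial.aeval_def]
      simp only [map_sub, map_sum, map_mul, map_pow, Polynomial.aeval_X, Polynomial.aeval_C]
      rw [e, sub_eq_zero]
      rfl
  obtain ⟨f, hf, rfl⟩ := hx
  obtain ⟨r, q, hr, hq, hf⟩ := wdiv h f hh hf b u hu hu0 hb
  rw [ev_decomp hev y hy h h0 b _ r q hf]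
  refine IsIntegral.sum _ fun j _ => IsIntegral.mul ?_ (hτ.pow _)
  exact isIntegral_algebraMap (R := Aev ev (fun n => (y n).2)) (x := ⟨_, hmem (r j) (hr j)⟩)

theorem step_der {ev : (ℕ → ℂ) →ₐ[ℂ] K}
    (hev : ∀ a : ℕ → ℂ, (∀ᶠ n in atTop, a n = 0) → ev a = 0)
    (y : ℕ → ℂ × E) (hy : Tendsto y atTop (nhds 0))
    (h : ℂ × E → ℂ) (hh : AnalyticAt ℂ h 0) (h0 : ev (fun n => h (y n)) = 0)
    (b : ℕ) (u : ℂ → ℂ) (hu : AnalyticAt ℂ u 0) (hu0 : u 0 ≠ 0)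
    (hb : ∀ᶠ t in nhds (0:ℂ), h (t,0) = t^b * u t)
    (D : Derivation ℂ K K) (hD : Der ev (fun n => (y n).2) D) : Der ev y D := by
  obtain ⟨k, c, v, hcv⟩ := hD
  refine ⟨k + 1, Fin.cons (D (ev (fun n => (y n).1))) c, Fin.cons (1, 0) (fun i => (0, v i)), ?_⟩
  set C : Fin (k + 1) → K := Fin.cons (D (ev (fun n => (y n).1))) c with hC
  set V : Fin (k + 1) → ℂ × E := Fin.cons (1, 0) (fun i => (0, v i)) with hV
  change ∀ f, AnalyticAt ℂ f 0 → D (ev (fun n => f (y n))) = dsum ev y C V f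
  have ev0 : ev (fun _ : ℕ => (0 : ℂ)) = 0 := map_zero ev
  have ev1 : ev (fun _ : ℕ => (1 : ℂ)) = 1 := map_one ev
  have gfst : Good ev y C V D (fun z => z.1) := by
    refine ⟨analyticAt_fst, ?_⟩
    simp [dsum, Fin.sum_univ_succ, hC, hV, fderiv_fst, ev0, ev1]
  have gsnd : ∀ r : E → ℂ, AnalyticAt ℂ r 0 → Good ev y C V D (fun z => r z.2) := by
    intro r hr
    have hr' : AnalyticAt ℂ r ((0 : ℂ × E).2) := hr
    refine ⟨hr'.comp analyticAt_snd, ?_⟩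
    rw [hcv r hr]
    have e1 : ∀ w : ℂ × E, ev (fun n => fderiv ℂ (fun z : ℂ × E => r z.2) (y n) w) =
        ev (fun n => fderiv ℂ r (y n).2 w.2) := by
      intro w
      have hy2 : Tendsto (fun n => (y n).2) atTop (nhds 0) :=
        (continuous_snd.tendsto (0 : ℂ × E)).comp hy
      refine ev_congr hev ((hy2.eventually hr.eventually_analyticAt).mono fun n hn => ?_)
      have := (hn.differentiableAt.hasFDerivAt.comp (y n) hasFDerivAt_snd).fderiv
      change fderiv ℂ (r ∘ Prod.snd) (y n) w = _
      rw [this]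
      rfl
    simp [dsum, Fin.sum_univ_succ, hC, hV, e1, ev0]
  have gR : ∀ r : Fin b → E → ℂ, (∀ j, AnalyticAt ℂ (r j) 0) →
      Good ev y C V D (fun z => ∑ j, r j z.2 * z.1 ^ (j:ℕ)) := fun r hr =>
    Good.sum hev y hy C V D _ _ fun j =>
      (gsnd _ (hr j)).mul hev y hy C V D (gfst.pow hev y hy C V D _)
  have main : ∀ (f : ℂ × E → ℂ) (r : Fin b → E → ℂ) (q : ℂ × E → ℂ), 
      (∀ j, AnalyticAt ℂ (r j) 0) → (∀ᶠ z in nhds (0:ℂ×E), ContinuousAt q z) → 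
      (∀ᶠ z in nhds (0:ℂ×E), f z = q z * h z + ∑ j, r j z.2 * z.1 ^ (j:ℕ)) →
      dsum ev y C V f = ev (fun n => q (y n)) * dsum ev y C V h + D (ev (fun n => f (y n))) := by
    intro f r q hr hq hf
    rw [ev_decomp hev y hy h h0 b _ r q hf]
    have e2 := ev_decomp hev y hy h h0 b (fun z => ∑ j, r j z.2 * z.1 ^ (j:ℕ)) r 0
      (by simp)
    rw [← e2, (gR r hr).2]
    refine dsum_congr_of hev y hy C V h f _ q h0 ?_
    filter_upwards [hq, hf.eventually_nhds, hh.eventually_analyticAt,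
      (gR r hr).1.eventually_analyticAt] with z z1 z2 z3 z4 hz
    rw [Filter.EventuallyEq.fderiv_eq z2]
    exact fderiv_mul_zero z1 z3.differentiableAt z4.differentiableAt hz
  have hδ : dsum ev y C V h = 0 := by
    obtain ⟨r, q, hr, hq, hf⟩ := wdiv h (fun z => z.1 ^ b) hh (analyticAt_fst.pow b) b u hu hu0 hb
    have e1 := main _ r q hr hq hf
    rw [← (gfst.pow hev y hy C V D b).2] at e1
    have hq0 : q 0 ≠ 0 := by
      intro hq0
      have hl : Tendsto (fun t : ℂ => ((t, 0) : ℂ × E)) (nhds 0) (nhds 0) := by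
        have : Continuous (fun t : ℂ => ((t, 0) : ℂ × E)) := by fun_prop
        exact this.tendsto 0
      refine poly_contra b (fun j => r j 0) (fun t => q (t, 0) * u t) ?_ ?_
      · have h1 : Tendsto (fun t : ℂ => q (t, 0)) (nhds 0) (nhds 0) := by
          have := hq.self_of_nhds.tendsto.comp hl
          rwa [hq0] at this
        simpa using h1.mul hu.continuousAt.tendsto
      · filter_upwards [hl.eventually hf, hb] with t h1 h2
        rw [h2] at h1
        rw [← mul_assoc, mul_comm (_ * _) (u t), ← mul_assoc, mul_comm (u t)] at h1
        exact h1
    have hq1 : ev (fun n => q (y n)) ≠ 0 :=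
      ev_ne_zero hev (hy.eventually (hq.self_of_nhds.eventually_ne hq0))
    refine (mul_eq_zero.1 ?_).resolve_left hq1
    linear_combination -e1
  intro f hf
  obtain ⟨r, q, hr, hq, hf⟩ := wdiv h f hh hf b u hu hu0 hb
  rw [main f r q hr hq hf, hδ]
  ring
end

theorem exists_dir (h : E → ℂ) (hh : AnalyticAt ℂ h 0) (hnz : ¬ ∀ᶠ z in nhds 0, h z = 0) :
    ∃ v : E, ¬ ∀ᶠ t : ℂ in nhds 0, h (t • v) = 0 := by
  by_contra hcon
  push Not at hcon
  apply hnz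
  obtain ⟨ε, hε, hball⟩ := Metric.eventually_nhds_iff_ball.1 hh.eventually_analyticAt
  filter_upwards [ball_mem_nhds _ hε] with z hz
  let L : ℂ →L[ℂ] E := (ContinuousLinearMap.id ℂ ℂ).smulRight z
  set S : Set ℂ := L ⁻¹' (ball 0 ε)
  have hS : Convex ℝ S := (convex_ball (0 : E) ε).is_linear_preimage (L.restrictScalars ℝ).isLinear
  have hA : AnalyticOnNhd ℂ (fun t => h (L t)) S := fun t ht => (hball _ ht).comp (L.analyticAt t)
  have h0 : (0 : ℂ) ∈ S := by simp [S, hε]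
  have h1 : (1 : ℂ) ∈ S := by simpa [S, L] using hz
  have := hA.eqOn_zero_of_preconnected_of_eventuallyEq_zero hS.isPreconnected h0 (hcon z)
  simpa [L] using this h1

theorem main_S {ev : (ℕ → ℂ) →ₐ[ℂ] K}
    (hev : ∀ a : ℕ → ℂ, (∀ᶠ n in atTop, a n = 0) → ev a = 0) (N : ℕ) :
    ∀ (E : Type) [NormedAddCommGroup E] [NormedSpace ℂ E] [FiniteDimensional ℂ E],
    Module.finrank ℂ E = N → ∀ (y : ℕ → E) (_ : Tendsto y atTop (nhds 0))
    (a : K) (_ : IsAlgebraic (Aev ev y) a) (_ : ∀ D, Der ev y D → D a = 0),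
    ∃ c : ℂ, algebraMap ℂ K c = a := by
  induction N using Nat.strong_induction_on with
  | _ N ih =>
  intro E _ _ _ hN y hy a ha hD
  by_cases hinj : ∀ h : E → ℂ, AnalyticAt ℂ h 0 → ev (fun n => h (y n)) = 0 →
      ∀ᶠ z in nhds 0, h z = 0
  · exact inj_case hev y hy hinj a ha hD
  push Not at hinj
  obtain ⟨h, hh, hh0, hnz⟩ := hinj
  obtain ⟨v, hv⟩ := exists_dir h hh (by rwa [Filter.not_eventually])
  have hv0 : v ≠ 0 := by
    rintro rfl
    have h00 : h 0 = 0 := by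
      by_contra hne
      exact ev_ne_zero hev (hy.eventually (hh.continuousAt.eventually_ne hne)) hh0
    simp [h00] at hv
  obtain ⟨l, hl⟩ := SeparatingDual.exists_eq_one (R := ℂ) hv0
  let s : ℂ →L[ℂ] E := (ContinuousLinearMap.id ℂ ℂ).smulRight v
  have hls : Function.RightInverse s l := fun t => by simp [s, hl]
  let e := ContinuousLinearEquiv.equivOfRightInverse l s hls
  let E' := LinearMap.ker l.toLinearMap
  have hdim : Module.finrank ℂ E' < N := by
    have := e.toLinearEquiv.finrank_eq
    rw [Module.finrank_prod, Module.finrank_self] at this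
    change Module.finrank ℂ (LinearMap.ker l.toLinearMap) < N
    omega
  let h2 : ℂ × E' → ℂ := fun z => h (e.symm z)
  let y2 : ℕ → ℂ × E' := fun n => e (y n)
  have hy2 : Tendsto y2 atTop (nhds 0) := by
    have := (e.continuous.tendsto 0).comp hy
    rwa [map_zero] at this
  have hsymm : ∀ f : E → ℂ, AnalyticAt ℂ f 0 → AnalyticAt ℂ (fun z => f (e.symm z)) 0 := by
    intro f hf
    have hf' : AnalyticAt ℂ f (e.symm 0) := by rwa [map_zero]
    exact hf'.comp (e.symm.toContinuousLinearMap.analyticAt 0)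
  have hh2 : AnalyticAt ℂ h2 0 := hsymm h hh
  have hh20 : ev (fun n => h2 (y2 n)) = 0 := by simpa [h2, y2] using hh0
  have hline : ∀ t : ℂ, h2 (t, 0) = h (t • v) := by
    intro t
    simp [h2, e, s]
  have hA : AnalyticAt ℂ (fun t : ℂ => h2 (t, 0)) 0 := by
    have : AnalyticAt ℂ (fun t : ℂ => ((t, 0) : ℂ × E')) 0 := analyticAt_id.prod analyticAt_const
    exact AnalyticAt.comp (g := h2) (f := fun t : ℂ => ((t, 0) : ℂ × E')) hh2 this
  have hex : ¬ ∀ᶠ t : ℂ in nhds 0, h2 (t, 0) = 0 := by simpa only [hline] using hv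
  obtain ⟨b, u, hu, hu0, hb⟩ := hA.exists_eventuallyEq_pow_smul_nonzero_iff.2 hex
  have hb' : ∀ᶠ t in nhds (0:ℂ), h2 (t,0) = t^b * u t := by simpa using hb
  refine ih _ hdim E' rfl (fun n => (y2 n).2) ((continuous_snd.tendsto (0 : ℂ × E')).comp hy2) a ?_ ?_
  · refine alg_trans (Aev ev (fun n => (y2 n).2)) (Aev ev y2) 
      (step_integral hev y2 hy2 h2 hh2 hh20 b u hu hu0 hb') a ?_
    have : Aev ev y = Aev ev y2 := by
      ext x
      constructor
      · rintro ⟨f, hf, rfl⟩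
        exact ⟨fun z => f (e.symm z), hsymm f hf, by simp [y2]⟩
      · rintro ⟨f, hf, rfl⟩
        have hf' : AnalyticAt ℂ f (e 0) := by rwa [map_zero]
        exact ⟨fun z => f (e z), hf'.comp (e.toContinuousLinearMap.analyticAt 0), rfl⟩
    rwa [← this]
  · intro D hD'
    apply hD
    obtain ⟨k, c, w, hcw⟩ := step_der hev y2 hy2 h2 hh2 hh20 b u hu hu0 hb' D hD'
    refine ⟨k, c, fun i => e.symm (w i), fun f hf => ?_⟩
    have := hcw (fun z => f (e.symm z)) (hsymm f hf)
    simp only [y2, ContinuousLinearEquiv.symm_apply_apply] at this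
    rw [this]
    refine Finset.sum_congr rfl fun i _ => ?_
    congr 1
    refine ev_congr hev ((hy.eventually hf.eventually_analyticAt).mono fun n hn => ?_)
    have hn' : HasFDerivAt f (fderiv ℂ f (y n)) (e.symm (e (y n))) := by
      rw [e.symm_apply_apply]; exact hn.differentiableAt.hasFDerivAt
    have := (hn'.comp (e (y n)) e.symm.hasFDerivAt).fderiv
    change fderiv ℂ (f ∘ e.symm) (e (y n)) (w i) = _
    rw [this]
    rfl
end


section
variable {X : Type} [NormedAddCommGroup X] [NormedSpace ℂ X] [StarAddMonoid X] [StarModule ℂ X]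
  [NormedStarGroup X]

theorem an_conj (f : X → ℂ) (hf : AnalyticAt ℂ f 0) :
    AnalyticAt ℂ (star ∘ f ∘ star) (0 : X) := by
  obtain ⟨p, r, hp⟩ := hf
  have hupd : ∀ {n : ℕ} (hdec : DecidableEq (Fin n)) (m : Fin n → X) (i : Fin n) (x : X),
      (fun j => star (Function.update m i x j)) =
        Function.update (fun j => star (m j)) i (star x) := by
    intro n hdec m i x
    funext j
    by_cases hj : j = i
    · subst hj; simp
    · simp [hj]
  let pm : ∀ n, MultilinearMap ℂ (fun _ : Fin n => X) ℂ := fun n =>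
    { toFun := fun m => star (p n (fun i => star (m i)))
      map_update_add' := by
        intro hdec m i x y
        rw [hupd, hupd, hupd, star_add, ContinuousMultilinearMap.map_update_add, star_add]
      map_update_smul' := by
        intro hdec m i c x
        rw [hupd, hupd, star_smul, ContinuousMultilinearMap.map_update_smul, star_smul, star_star] }
  have hbd : ∀ n m, ‖pm n m‖ ≤ ‖p n‖ * ∏ i, ‖m i‖ := by
    intro n m
    change ‖star (p n (fun i => star (m i)))‖ ≤ _
    rw [norm_star]
    refine ((p n).le_opNorm _).trans ?_
    simp
  let q : FormalMultilinearSeries ℂ X ℂ := fun n => (pm n).mkContinuous ‖p n‖ (hbd n)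
  have hq : ∀ n, ‖q n‖ ≤ ‖p n‖ := fun n =>
    MultilinearMap.mkContinuous_norm_le _ (norm_nonneg _) _
  refine ⟨q, r, ?_, hp.r_pos, ?_⟩
  · refine ENNReal.le_of_forall_nnreal_lt fun s hs => ?_
    obtain ⟨C, hC, hC'⟩ := p.norm_mul_pow_le_of_lt_radius (hs.trans_le hp.r_le)
    exact q.le_radius_of_bound C fun n =>
      (mul_le_mul_of_nonneg_right (hq n) (by positivity)).trans (hC' n)
  · intro y hy
    have hy' : star y ∈ Metric.eball (0 : X) r := by
      rw [Metric.mem_eball, edist_zero_right] at hy ⊢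
      rwa [← ofReal_norm, norm_star, ofReal_norm]
    have := (hp.hasSum hy').star
    simp only [zero_add] at this ⊢
    exact this

end

section
variable {K : Type} [Field K] [Algebra ℂ K]
variable {E : Type} [NormedAddCommGroup E] [NormedSpace ℂ E]

theorem ode_D {ev : (ℕ → ℂ) →ₐ[ℂ] K}
    (hev : ∀ a : ℕ → ℂ, (∀ᶠ n in atTop, a n = 0) → ev a = 0)
    (y : ℕ → E) (hy : Tendsto y atTop (nhds 0)) {g : ℕ}
    (f : E → ℂ) (G t : Fin g → E → ℂ) (hf : AnalyticAt ℂ f 0) (hG : ∀ j, AnalyticAt ℂ (G j) 0)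
    (H : ∀ᶠ z in nhds 0, ∀ v, fderiv ℂ f z v = ∑ j, t j z * fderiv ℂ (G j) z v)
    (D : Derivation ℂ K K) (hD : Der ev y D) :
    D (ev (fun n => f (y n))) = ∑ j, ev (fun n => t j (y n)) * D (ev (fun n => G j (y n))) := by
  obtain ⟨k, c, v, hcv⟩ := hD
  rw [hcv f hf]
  simp_rw [fun j => hcv (G j) (hG j), Finset.mul_sum]
  rw [Finset.sum_comm]
  refine Finset.sum_congr rfl fun i _ => ?_
  have : ev (fun n => fderiv ℂ f (y n) (v i)) =
      ev (∑ j, (fun n => t j (y n)) * fun n => fderiv ℂ (G j) (y n) (v i)) :=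
    ev_congr hev ((hy.eventually H).mono fun n hn => by simp [hn])
  rw [this, map_sum, Finset.mul_sum]
  refine Finset.sum_congr rfl fun j _ => ?_
  rw [map_mul]
  ring

theorem const_zero {ev : (ℕ → ℂ) →ₐ[ℂ] K}
    (hev : ∀ a : ℕ → ℂ, (∀ᶠ n in atTop, a n = 0) → ev a = 0)
    (a : ℕ → ℂ) (ha : Tendsto a atTop (nhds 0)) (h : ∃ c : ℂ, algebraMap ℂ K c = ev a) :
    ev a = 0 := by
  obtain ⟨c, hc⟩ := h
  rcases eq_or_ne c 0 with rfl | hc0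
  · rw [← hc, map_zero]
  · exfalso
    have h1 : ev (a - algebraMap ℂ (ℕ → ℂ) c) = 0 := by
      rw [map_sub, AlgHom.commutes, hc, sub_self]
    refine ev_ne_zero hev (a := a - algebraMap ℂ (ℕ → ℂ) c) ?_ h1
    filter_upwards [ha.eventually_ne hc0.symm] with n hn
    exact sub_ne_zero.2 hn

end

theorem exists_ev : ∃ (K : Type) (_ : Field K) (_ : Algebra ℂ K) (ev : (ℕ → ℂ) →ₐ[ℂ] K),
    ∀ a : ℕ → ℂ, (∀ᶠ n in atTop, a n = 0) → ev a = 0 := by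
  let I : Ideal (ℕ → ℂ) :=
    { carrier := {a | ∀ᶠ n in atTop, a n = 0}
      add_mem' := fun {a b} ha hb => (Filter.Eventually.and ha hb).mono fun n hn => by
        simp [hn.1, hn.2]
      zero_mem' := Eventually.of_forall fun _ => rfl
      smul_mem' := fun c a ha => Filter.Eventually.mono ha fun n hn => by simp [hn] }
  have hI : I ≠ ⊤ := by
    rw [Ideal.ne_top_iff_one]
    intro h
    have h' : ∀ᶠ n : ℕ in atTop, (1 : ℕ → ℂ) n = 0 := h
    obtain ⟨n, hn⟩ := h'.exists
    simp at hn
  obtain ⟨M, hM, hIM⟩ := Ideal.exists_le_maximal I hI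
  exact ⟨(ℕ → ℂ) ⧸ M, Ideal.Quotient.field M, Ideal.Quotient.algebra ℂ, Ideal.Quotient.mkₐ ℂ M,
    fun a ha => Ideal.Quotient.eq_zero_iff_mem.2 (hIM ha)⟩


theorem ode_all {d g : ℕ} (F G : (Fin d → ℂ) → Fin g → ℂ)
    (τ : (Fin d → ℂ) → Matrix (Fin g) (Fin g) ℂ) (z : Fin d → ℂ)
    (hode : ∀ m : Fin d,
      (fun i => fderiv ℂ (fun w => G w i) z (Pi.single m 1)) =
        (τ z).mulVec (fun j => fderiv ℂ (fun w => F w j) z (Pi.single m 1)))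
    (i : Fin g) (v : Fin d → ℂ) :
    fderiv ℂ (fun w => G w i) z v = ∑ j, τ z i j * fderiv ℂ (fun w => F w j) z v := by
  have hL : fderiv ℂ (fun w => G w i) z = ∑ j, τ z i j • fderiv ℂ (fun w => F w j) z := by
    apply ContinuousLinearMap.coe_injective
    refine LinearMap.pi_ext' fun m => LinearMap.ext_ring ?_
    have := congrFun (hode m) i
    simp only [Matrix.mulVec, dotProduct] at this
    simpa [_root_.sum_apply] using this
  rw [hL]
  simp

section
variable {X : Type} [NormedAddCommGroup X] [NormedSpace ℂ X] [StarAddMonoid X] [StarModule ℂ X]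
  [NormedStarGroup X]

theorem fderiv_star_star (f : X → ℂ) (w v : X) (hf : DifferentiableAt ℂ f (star w)) :
    fderiv ℂ (star ∘ f ∘ star) w v = star (fderiv ℂ f (star w) (star v)) := by
  have := hf.hasFDerivAt.star_star.fderiv
  rw [star_star] at this
  rw [this]
  rfl
end

theorem fderiv_comp_fst {X Y : Type} [NormedAddCommGroup X] [NormedSpace ℂ X]
    [NormedAddCommGroup Y] [NormedSpace ℂ Y] (f : X → ℂ) (z v : X × Y)
    (hf : DifferentiableAt ℂ f z.1) :
    fderiv ℂ (fun z : X × Y => f z.1) z v = fderiv ℂ f z.1 v.1 := by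
  have := (hf.hasFDerivAt.comp z hasFDerivAt_fst).fderiv
  change fderiv ℂ (f ∘ Prod.fst) z v = _
  rw [this]; rfl

theorem fderiv_comp_snd {X Y : Type} [NormedAddCommGroup X] [NormedSpace ℂ X]
    [NormedAddCommGroup Y] [NormedSpace ℂ Y] (f : Y → ℂ) (z v : X × Y)
    (hf : DifferentiableAt ℂ f z.2) :
    fderiv ℂ (fun z : X × Y => f z.2) z v = fderiv ℂ f z.2 v.2 := by
  have := (hf.hasFDerivAt.comp z hasFDerivAt_snd).fderiv
  change fderiv ℂ (f ∘ Prod.snd) z v = _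
  rw [this]; rfl

theorem stmt_13 (d g : ℕ) (hd : 1 ≤ d) (hg : 1 ≤ g) (ρ : ℝ) (hρ : 0 < ρ)
    (F G : (Fin d → ℂ) → Fin g → ℂ)
    (τ : (Fin d → ℂ) → Matrix (Fin g) (Fin g) ℂ)
    (hF : AnalyticOnNhd ℂ F (ball 0 ρ)) (hG : AnalyticOnNhd ℂ G (ball 0 ρ))
    (hτ : ∀ i j : Fin g, AnalyticOnNhd ℂ (fun w => τ w i j) (ball 0 ρ))
    (hF0 : F 0 = 0) (hG0 : G 0 = 0)
    (hdet : ((τ 0).map Complex.im).det ≠ 0)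
    (hode : ∀ z ∈ ball (0 : Fin d → ℂ) ρ, ∀ m : Fin d,
      (fun i => fderiv ℂ (fun w => G w i) z (Pi.single m 1)) =
        (τ z).mulVec (fun j => fderiv ℂ (fun w => F w j) z (Pi.single m 1)))
    (x : ℕ → Fin d → ℂ) (hx : ∀ n, x n ∈ ball (0 : Fin d → ℂ) ρ)
    (hxne : ∀ n, x n ≠ 0) (hlim : Tendsto x atTop (nhds 0))
    (hImF : ∀ n, ∀ i, (F (x n) i).im = 0)
    (hImG : ∀ n, ∀ i, (G (x n) i).im = 0) :
    ∃ φ : ℕ → ℕ, StrictMono φ ∧ ∀ k, F (x (φ k)) = 0 ∧ G (x (φ k)) = 0 := by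
  obtain ⟨K, _, _, ev, hev⟩ := exists_ev
  have h0m : (0 : Fin d → ℂ) ∈ ball (0 : Fin d → ℂ) ρ := mem_ball_self hρ
  have hFj : ∀ j, ∀ z ∈ ball (0 : Fin d → ℂ) ρ, AnalyticAt ℂ (fun w => F w j) z := fun j z hz =>
    ((ContinuousLinearMap.proj (R := ℂ) (φ := fun _ : Fin g => ℂ) j).analyticAt _).comp (hF z hz)
  have hGj : ∀ j, ∀ z ∈ ball (0 : Fin d → ℂ) ρ, AnalyticAt ℂ (fun w => G w j) z := fun j z hz =>
    ((ContinuousLinearMap.proj (R := ℂ) (φ := fun _ : Fin g => ℂ) j).analyticAt _).comp (hG z hz)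
  let y : ℕ → (Fin d → ℂ) × (Fin d → ℂ) := fun n => (x n, star (x n))
  have hstar : Tendsto (fun n => star (x n)) atTop (nhds 0) := by
    simpa using hlim.star
  have hy : Tendsto y atTop (nhds 0) := hlim.prodMk_nhds hstar
  have han1 : ∀ f : (Fin d → ℂ) → ℂ, AnalyticAt ℂ f 0 →
      AnalyticAt ℂ (fun z : (Fin d → ℂ) × (Fin d → ℂ) => f z.1) 0 := fun f hf =>
    AnalyticAt.comp (g := f) (f := Prod.fst) (x := (0 : (Fin d → ℂ) × (Fin d → ℂ))) hf
      analyticAt_fst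
  have han2 : ∀ f : (Fin d → ℂ) → ℂ, AnalyticAt ℂ f 0 →
      AnalyticAt ℂ (fun z : (Fin d → ℂ) × (Fin d → ℂ) => (star ∘ f ∘ star) z.2) 0 := fun f hf =>
    AnalyticAt.comp (g := star ∘ f ∘ star) (f := Prod.snd)
      (x := (0 : (Fin d → ℂ) × (Fin d → ℂ))) (an_conj f hf) analyticAt_snd
  have ode1 : ∀ i, ∀ᶠ z in nhds (0 : (Fin d → ℂ) × (Fin d → ℂ)), ∀ v,
      fderiv ℂ (fun z : (Fin d → ℂ) × (Fin d → ℂ) => G z.1 i) z v = ∑ j, τ z.1 i j *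
        fderiv ℂ (fun z : (Fin d → ℂ) × (Fin d → ℂ) => F z.1 j) z v := by
    intro i
    have hm : ∀ᶠ z in nhds (0 : (Fin d → ℂ) × (Fin d → ℂ)), z.1 ∈ ball (0 : Fin d → ℂ) ρ :=
      (continuous_fst.tendsto (0 : (Fin d → ℂ) × (Fin d → ℂ))).eventually
        (isOpen_ball.mem_nhds h0m)
    filter_upwards [hm] with z hz v
    rw [fderiv_comp_fst (fun w => G w i) z v (hGj i _ hz).differentiableAt,
      ode_all F G τ z.1 (hode _ hz) i v.1]
    refine Finset.sum_congr rfl fun j _ => ?_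
    rw [fderiv_comp_fst (fun w => F w j) z v (hFj j _ hz).differentiableAt]
  have ode2 : ∀ i, ∀ᶠ z in nhds (0 : (Fin d → ℂ) × (Fin d → ℂ)), ∀ v,
      fderiv ℂ (fun z : (Fin d → ℂ) × (Fin d → ℂ) => (star ∘ (fun w => G w i) ∘ star) z.2) z v =
        ∑ j, star (τ (star z.2) i j) *
        fderiv ℂ (fun z : (Fin d → ℂ) × (Fin d → ℂ) =>
          (star ∘ (fun w => F w j) ∘ star) z.2) z v := by
    intro i
    have hm : ∀ᶠ z in nhds (0 : (Fin d → ℂ) × (Fin d → ℂ)), z.2 ∈ ball (0 : Fin d → ℂ) ρ :=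
      (continuous_snd.tendsto (0 : (Fin d → ℂ) × (Fin d → ℂ))).eventually
        (isOpen_ball.mem_nhds h0m)
    filter_upwards [hm] with z hz v
    have hz' : star z.2 ∈ ball (0 : Fin d → ℂ) ρ := by
      rw [mem_ball_zero_iff] at hz ⊢
      rwa [norm_star]
    have hd' : ∀ f : (Fin d → ℂ) → ℂ, AnalyticAt ℂ f (star z.2) →
        fderiv ℂ (fun z : (Fin d → ℂ) × (Fin d → ℂ) => (star ∘ f ∘ star) z.2) z v =
          star (fderiv ℂ f (star z.2) (star v.2)) := by
      intro f hf
      have h1 := hf.differentiableAt.star_star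
      rw [star_star] at h1
      rw [fderiv_comp_snd (star ∘ f ∘ star) z v h1, fderiv_star_star _ _ _ hf.differentiableAt]
    rw [hd' _ (hGj i _ hz'), ode_all F G τ _ (hode _ hz') i, star_sum]
    refine Finset.sum_congr rfl fun j _ => ?_
    rw [hd' _ (hFj j _ hz'), star_mul']
  have hreF : ∀ n j, star (F (x n) j) = F (x n) j := fun n j =>
    Complex.conj_eq_iff_im.2 (hImF n j)
  have hreG : ∀ n j, star (G (x n) j) = G (x n) j := fun n j =>
    Complex.conj_eq_iff_im.2 (hImG n j)
  -- derivations kill the values of `F` and `G`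
  have hD : ∀ D : Derivation ℂ K K, Der ev y D →
      (∀ j, D (ev (fun n => F (x n) j)) = 0) ∧ ∀ j, D (ev (fun n => G (x n) j)) = 0 := by
    intro D hDer
    have e1 : ∀ i, D (ev (fun n => G (x n) i)) =
        ∑ j, ev (fun n => τ (x n) i j) * D (ev (fun n => F (x n) j)) := fun i =>
      ode_D hev y hy _ (fun j z => F z.1 j) (fun j z => τ z.1 i j) (han1 _ (hGj i 0 h0m))
        (fun j => han1 _ (hFj j 0 h0m)) (ode1 i) D hDer
    have e2 : ∀ i, D (ev (fun n => G (x n) i)) =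
        ∑ j, ev (fun n => star (τ (x n) i j)) * D (ev (fun n => F (x n) j)) := by
      intro i
      have := ode_D hev y hy _ (fun j z => (star ∘ (fun w => F w j) ∘ star) z.2)
        (fun j z => star (τ (star z.2) i j)) (han2 _ (hGj i 0 h0m))
        (fun j => han2 _ (hFj j 0 h0m)) (ode2 i) D hDer
      simpa only [y, Function.comp_apply, star_star, hreF, hreG] using this
    let A : Matrix (Fin g) (Fin g) (ℕ → ℂ) := fun i j n => τ (x n) i j - star (τ (x n) i j)
    have hdetA : ev A.det ≠ 0 := by
      apply ev_ne_zero hev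
      have h1 : ∀ n, A.det n = (Matrix.of fun i j => τ (x n) i j - star (τ (x n) i j)).det := by
        intro n
        have := (Pi.evalRingHom (fun _ : ℕ => ℂ) n).map_det A
        simp only [Pi.evalRingHom_apply] at this
        rw [this]
        rfl
      have h2 : Tendsto (fun n => (Matrix.of fun i j => τ (x n) i j - star (τ (x n) i j)).det)
          atTop (nhds (Matrix.of fun i j => τ 0 i j - star (τ 0 i j)).det) := by
        have hc : Continuous (fun M : Matrix (Fin g) (Fin g) ℂ => M.det) := continuous_id.matrix_det
        refine (hc.tendsto _).comp ?_
        refine tendsto_pi_nhds.2 fun i => tendsto_pi_nhds.2 fun j => ?_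
        have := (hτ i j 0 h0m).continuousAt.tendsto.comp hlim
        exact this.sub this.star
      have h3 : (Matrix.of fun i j => τ 0 i j - star (τ 0 i j)).det ≠ 0 := by
        have : (Matrix.of fun i j => τ 0 i j - star (τ 0 i j)) =
            (2 * Complex.I) • ((τ 0).map Complex.im).map Complex.ofRealHom := by
          ext i j
          simp only [Matrix.of_apply, Matrix.smul_apply, Matrix.map_apply, smul_eq_mul]
          apply Complex.ext <;> simp
          ring
        rw [this, Matrix.det_smul]
        refine mul_ne_zero (pow_ne_zero _ (by simp)) ?_
        have h4 := Complex.ofRealHom.map_det ((τ 0).map Complex.im)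
        rw [RingHom.mapMatrix_apply] at h4
        rw [← h4]
        simpa using hdet
      filter_upwards [h2.eventually_ne h3] with n hn
      rwa [h1]
    have hzero : (fun j => D (ev (fun n => F (x n) j))) = 0 := by
      refine Matrix.eq_zero_of_mulVec_eq_zero (M := (ev : (ℕ → ℂ) →+* K).mapMatrix A) ?_ ?_
      · rw [← RingHom.map_det]
        exact hdetA
      · funext i
        simp only [Matrix.mulVec, dotProduct, RingHom.mapMatrix_apply, Matrix.map_apply,
          Pi.zero_apply]
        have e3 : ∀ j, (ev : (ℕ → ℂ) →+* K) (A i j) =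
            ev (fun n => τ (x n) i j) - ev (fun n => star (τ (x n) i j)) := by
          intro j
          rw [← map_sub]
          rfl
        simp_rw [e3, sub_mul]
        rw [Finset.sum_sub_distrib, ← e1 i, ← e2 i, sub_self]
    have hz : ∀ j, D (ev (fun n => F (x n) j)) = 0 := fun j => congrFun hzero j
    refine ⟨hz, fun i => ?_⟩
    rw [e1 i]
    simp [hz]
  -- hence these values are constants, equal to zero
  have hkill : ∀ f : (Fin d → ℂ) → ℂ, AnalyticAt ℂ f 0 → f 0 = 0 →
      (∀ D : Derivation ℂ K K, Der ev y D → D (ev (fun n => f (x n))) = 0) →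
      ev (fun n => f (x n)) = 0 := by
    intro f hf hf0 hDf
    apply const_zero hev
    · have := hf.continuousAt.tendsto.comp hlim
      rwa [hf0] at this
    · refine main_S hev _ _ rfl y hy _ ?_ hDf
      have hmem : ev (fun n => f (x n)) ∈ Aev ev y := ⟨fun z => f z.1, han1 f hf, rfl⟩
      exact isAlgebraic_algebraMap (R := Aev ev y) (A := K) ⟨_, hmem⟩
  have kF : ∀ j, ev (fun n => F (x n) j) = 0 := fun j =>
    hkill (fun w => F w j) (hFj j 0 h0m) (by simp [hF0]) fun D hD' => (hD D hD').1 j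
  have kG : ∀ j, ev (fun n => G (x n) j) = 0 := fun j =>
    hkill (fun w => G w j) (hGj j 0 h0m) (by simp [hG0]) fun D hD' => (hD D hD').2 j
  have hfreq : ∃ᶠ n in atTop, F (x n) = 0 ∧ G (x n) = 0 := by
    by_contra hcon
    rw [Filter.not_frequently] at hcon
    let s : ℕ → ℂ := ∑ j, ((fun n => F (x n) j) ^ 2 + (fun n => G (x n) j) ^ 2)
    have hs : ev s = 0 := by
      simp only [s, map_sum, map_add, map_pow, kF, kG]
      simp
    refine ev_ne_zero hev (hcon.mono fun n hn => ?_) hs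
    intro hsn
    apply hn
    have hF' : ∀ j, F (x n) j = ((F (x n) j).re : ℂ) := fun j =>
      Complex.ext rfl (by simp [hImF n j])
    have hG' : ∀ j, G (x n) j = ((G (x n) j).re : ℂ) := fun j =>
      Complex.ext rfl (by simp [hImG n j])
    have h1 : ∑ j, ((F (x n) j).re ^ 2 + (G (x n) j).re ^ 2) = 0 := by
      have : s n = ((∑ j, ((F (x n) j).re ^ 2 + (G (x n) j).re ^ 2) : ℝ) : ℂ) := by
        simp only [s, Finset.sum_apply, Pi.add_apply, Pi.pow_apply]
        push_cast
        refine Finset.sum_congr rfl fun j _ => ?_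
        rw [← hF' j, ← hG' j]
      rw [hsn] at this
      exact_mod_cast this.symm
    rw [Finset.sum_eq_zero_iff_of_nonneg (fun j _ => by positivity)] at h1
    constructor
    · funext j
      have := h1 j (Finset.mem_univ j)
      rw [hF' j]
      have : (F (x n) j).re = 0 := by nlinarith [sq_nonneg (F (x n) j).re, sq_nonneg (G (x n) j).re]
      simp [this]
    · funext j
      have := h1 j (Finset.mem_univ j)
      rw [hG' j]
      have : (G (x n) j).re = 0 := by nlinarith [sq_nonneg (F (x n) j).re, sq_nonneg (G (x n) j).re]
      simp [this]
  exact extraction_of_frequently_atTop hfreq
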